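/- arXiv:1509.04935 — 12 statements merged into one kernel-verified Lean document; each statement's English description precedes it below -/
import Mathlib

section
/- For every positive integer n, the sum over all partitions λ = (λ_1, …, λ_n) of n (weakly decreasing nonnegative integers with λ_1 + ⋯ + λ_n = n, padded with trailing zeros to length n) of (f^λ)² · ∏_{i=1}^{n} (n+i)!/(n+i−λ_i)! equals (n+1)^n · n!. -/
open Finset

/-- `fSYT e lam` is the rational number
`|λ|! · ∏_{1 ≤ i < j ≤ e} (λ_i − λ_j + j − i) / ∏_{1 ≤ i ≤ e} (λ_i + e − i)!`,
for a tuple `λ = (λ_1, …, λ_e)` encoded as `lam : Fin e → ℕ` (0-indexed).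
By the hook length formula this is the number of standard Young tableaux
of shape `λ` when `λ` is weakly decreasing. -/
def fSYT (e : ℕ) (lam : Fin e → ℕ) : ℚ :=
  ((∑ i, lam i).factorial : ℚ) *
    (∏ i : Fin e, ∏ j ∈ Finset.Ioi i,
      ((lam i : ℚ) - (lam j : ℚ) + ((j : ℕ) : ℚ) - ((i : ℕ) : ℚ))) /
  ∏ i : Fin e, ((lam i + e - 1 - (i : ℕ)).factorial : ℚ)

/-- The finset of partitions of `n` with at most `e` parts, encoded as weakly
decreasing functions `Fin e → ℕ` (padded with trailing zeros) summing to `n`. -/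
def partitionsOf (e n : ℕ) : Finset (Fin e → ℕ) :=
  (Fintype.piFinset fun _ : Fin e => Finset.range (n + 1)).filter
    (fun lam => (∀ i j : Fin e, i ≤ j → lam j ≤ lam i) ∧ ∑ i, lam i = n)

open Polynomial in
/-- The top coefficients of the polynomial interpolating the removal of a box. -/
theorem natDegree_coeff_removal {ι : Type*} (s : Finset ι) (v : ι → ℚ) :
    (X * ((X - C (#s : ℚ)) * ∏ j ∈ s, (X - C (v j)) -
      X * ∏ j ∈ s, (X - C (v j + 1)))).natDegree ≤ #s ∧
    (X * ((X - C (#s : ℚ)) * ∏ j ∈ s, (X - C (v j)) -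
      X * ∏ j ∈ s, (X - C (v j + 1)))).coeff #s = ∑ j ∈ s, v j - #s * (#s - 1) / 2 := by
  classical
  induction s using Finset.induction_on with
  | empty => simp
  | insert a s ha ih =>
    obtain ⟨hd, hc⟩ := ih
    rw [prod_insert ha, prod_insert ha, sum_insert ha, card_insert_of_notMem ha]
    set Q := ∏ j ∈ s, (X - C (v j)) with hQ
    set T := ∏ j ∈ s, (X - C (v j + 1))
    set P := X * ((X - C (#s : ℚ)) * Q - X * T) with hP
    have hQd : Q.natDegree = #s := by simp [hQ]
    have hQm : Q.Monic := monic_prod_X_sub_C _ _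
    have key : X * ((X - C ((#s + 1 : ℕ) : ℚ)) * ((X - C (v a)) * Q) -
        X * ((X - C (v a + 1)) * T)) =
        (X - C (v a + 1)) * P + C (v a - #s) * (X * Q) := by
      simp only [hP, C_add, C_sub, Nat.cast_add, Nat.cast_one, C_1]
      ring
    have hXQ : (X * Q).natDegree ≤ #s + 1 := by
      rw [natDegree_X_mul hQm.ne_zero, hQd]
    rw [key]
    clear_value P Q T
    refine ⟨?_, ?_⟩
    · refine natDegree_add_le_of_degree_le ?_ ((natDegree_C_mul_le _ _).trans hXQ)
      refine natDegree_mul_le.trans ?_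
      rw [natDegree_X_sub_C]
      omega
    · rw [coeff_add, coeff_C_mul, sub_mul, coeff_sub, coeff_X_mul, coeff_C_mul, coeff_X_mul, hc,
        coeff_eq_zero_of_natDegree_lt (p := P) (by omega), ← hQd, hQm.coeff_natDegree, hQd]
      push_cast
      ring

open Polynomial in
/-- The top coefficients of the polynomial interpolating the addition of a box. -/
theorem natDegree_coeff_addition {ι : Type*} (s : Finset ι) (v : ι → ℚ) (M : ℚ) :
    ((C M - X) * ∏ j ∈ s, (X - C (v j - 1)) + X * ∏ j ∈ s, (X - C (v j))).natDegree ≤ #s ∧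
    ((C M - X) * ∏ j ∈ s, (X - C (v j - 1)) + X * ∏ j ∈ s, (X - C (v j))).coeff #s = M - #s := by
  classical
  induction s using Finset.induction_on with
  | empty => simp
  | insert a s ha ih =>
    obtain ⟨hd, hc⟩ := ih
    rw [prod_insert ha, prod_insert ha, card_insert_of_notMem ha]
    set Q := ∏ j ∈ s, (X - C (v j)) with hQ
    set T := ∏ j ∈ s, (X - C (v j - 1))
    set P := (C M - X) * T + X * Q with hP
    have hQd : Q.natDegree = #s := by simp [hQ]
    have hQm : Q.Monic := monic_prod_X_sub_C _ _
    have key : (C M - X) * ((X - C (v a - 1)) * T) + X * ((X - C (v a)) * Q) =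
        (X - C (v a - 1)) * P - X * Q := by
      simp only [hP, C_sub, C_1]
      ring
    have hXQ : (X * Q).natDegree ≤ #s + 1 := by
      rw [natDegree_X_mul hQm.ne_zero, hQd]
    rw [key]
    clear_value P Q T
    refine ⟨?_, ?_⟩
    · refine (natDegree_sub_le _ _).trans (max_le ?_ hXQ)
      refine natDegree_mul_le.trans ?_
      rw [natDegree_X_sub_C]
      omega
    · rw [coeff_sub, sub_mul, coeff_sub, coeff_X_mul, coeff_C_mul, coeff_X_mul, hc,
        coeff_eq_zero_of_natDegree_lt (p := P) (by omega), ← hQd, hQm.coeff_natDegree, hQd]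
      push_cast
      ring

/-- The product of the differences `v i - v j` over `i < j`. -/
def diffProd {e : ℕ} (v : Fin e → ℚ) : ℚ := ∏ i, ∏ j ∈ Ioi i, (v i - v j)

theorem diffProd_eq_zero {e : ℕ} {v : Fin e → ℚ} {i j : Fin e} (hij : i < j) (h : v i = v j) :
    diffProd v = 0 :=
  prod_eq_zero (mem_univ i) <| prod_eq_zero (mem_Ioi.2 hij) (sub_eq_zero.2 h)

theorem diffProd_update {e : ℕ} {v : Fin e → ℚ} (hv : Function.Injective v) (i : Fin e) (x : ℚ) :
    diffProd (Function.update v i x) =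
      diffProd v * ∏ j ∈ univ.erase i, ((x - v j) / (v i - v j)) := by
  have hterm : ∀ a, ∀ b ∈ Ioi a, Function.update v i x a - Function.update v i x b =
      (v a - v b) * ((if a = i then (x - v b) / (v i - v b) else 1) *
        (if b = i then (x - v a) / (v i - v a) else 1)) := by
    intro a b hab
    have hab : a < b := mem_Ioi.1 hab
    have h0 : v a - v b ≠ 0 := sub_ne_zero.2 fun h => hab.ne (hv h)
    have h1 : v b - v a ≠ 0 := sub_ne_zero.2 fun h => hab.ne' (hv h)
    by_cases ha : a = i
    · subst ha
      rw [Function.update_self, Function.update_of_ne hab.ne', if_pos rfl, if_neg hab.ne']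
      field_simp
    · by_cases hb : b = i
      · subst hb
        rw [Function.update_self, Function.update_of_ne ha, if_pos rfl, if_neg ha]
        field_simp
        ring
      · simp [ha, hb]
  have hsplit : univ.erase i = (Ioi i).disjUnion (Iio i) (by
      rw [Finset.disjoint_left]; intro a h1 h2
      exact lt_asymm (mem_Ioi.1 h1) (mem_Iio.1 h2)) := by
    ext a
    simp only [mem_erase, mem_univ, and_true, disjUnion_eq_union, mem_union, mem_Ioi, mem_Iio]
    rw [ne_iff_lt_or_gt, or_comm]
  unfold diffProd
  rw [prod_congr rfl fun a _ => prod_congr rfl (hterm a)]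
  simp_rw [prod_mul_distrib]
  rw [hsplit, prod_disjUnion]
  congr 2
  · rw [prod_eq_single i (fun b _ hb => by simp [hb]) (by simp)]
    simp
  · rw [← prod_subset (subset_univ (Iio i))]
    · refine prod_congr rfl fun a ha => ?_
      rw [prod_ite_eq', if_pos (mem_Ioi.2 (mem_Iio.1 ha))]
    · intro a _ ha
      rw [prod_ite_eq', if_neg]
      simpa using ha

open Polynomial in
theorem sum_mul_diffProd_update_sub_one {e : ℕ} {v : Fin e → ℚ} (hv : Function.Injective v) :
    ∑ i, v i * diffProd (Function.update v i (v i - 1)) =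
      (∑ i, v i - e * (e - 1) / 2) * diffProd v := by
  rcases Nat.eq_zero_or_pos e with rfl | he
  · simp
  obtain ⟨hd, hc⟩ := natDegree_coeff_removal univ v
  set P := (X - C (#(univ : Finset (Fin e)) : ℚ)) * ∏ j, (X - C (v j)) -
      X * ∏ j, (X - C (v j + 1)) with hP
  have hcard : #(univ : Finset (Fin e)) = e := by simp
  have hdeg : P.degree < (#(univ : Finset (Fin e)) : ℕ) := by
    rcases eq_or_ne P 0 with h0 | h0
    · rw [h0, degree_zero]
      exact WithBot.bot_lt_coe _
    · rw [natDegree_X_mul h0] at hd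
      rw [degree_eq_natDegree h0]
      exact_mod_cast hd
  have hsum := Lagrange.coeff_eq_sum hv.injOn hdeg
  rw [← coeff_X_mul, Nat.sub_add_cancel (by omega), hc, hcard] at hsum
  rw [hsum, sum_mul]
  refine sum_congr rfl fun i _ => ?_
  have heval : P.eval (v i) = v i * ∏ j ∈ univ.erase i, (v i - 1 - v j) := by
    simp only [hP, eval_sub, eval_mul, eval_X, eval_prod, eval_C]
    rw [prod_eq_zero (mem_univ i) (sub_self _), ← mul_prod_erase univ _ (mem_univ i)]
    simp [sub_sub, add_comm]
  rw [diffProd_update hv, heval, prod_div_distrib]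
  ring

open Polynomial in
theorem sum_mul_diffProd_update_add_one {e : ℕ} {v : Fin e → ℚ} (hv : Function.Injective v)
    (hv1 : ∀ i, v i + 1 ≠ 0) {k : Fin e} (hk : v k = 0) (M : ℚ) :
    ∑ i, (M - v i) / (v i + 1) * diffProd (Function.update v i (v i + 1)) =
      (M + 1 - e) * diffProd v := by
  obtain ⟨hd, hc⟩ := natDegree_coeff_addition (univ.erase k) v M
  set P := (C M - X) * ∏ j ∈ univ.erase k, (X - C (v j - 1)) +
    X * ∏ j ∈ univ.erase k, (X - C (v j)) with hP
  have he : 0 < e := k.pos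
  have hcard : #(univ : Finset (Fin e)) = e := by simp
  have hcard' : #(univ.erase k) = e - 1 := by simp
  have hdeg : P.degree < (#(univ : Finset (Fin e)) : ℕ) := by
    refine degree_le_natDegree.trans_lt ?_
    rw [hcard]
    exact_mod_cast (by omega : P.natDegree < e)
  have hsum := Lagrange.coeff_eq_sum hv.injOn hdeg
  rw [hcard, ← hcard', hc, hcard', Nat.cast_sub he, Nat.cast_one, sub_sub_eq_add_sub] at hsum
  rw [hsum, sum_mul]
  refine sum_congr rfl fun i _ => ?_
  have hzero : v i * ∏ j ∈ univ.erase k, (v i - v j) = 0 := by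
    by_cases hik : i = k
    · simp [hik, hk]
    · rw [prod_eq_zero (mem_erase.2 ⟨hik, mem_univ i⟩) (sub_self _), mul_zero]
  have hprod : (v i + 1) * ∏ j ∈ univ.erase k, (v i + 1 - v j) =
      ∏ j ∈ univ.erase i, (v i + 1 - v j) := by
    have h1 := mul_prod_erase univ (fun j => v i + 1 - v j) (mem_univ k)
    have h2 := mul_prod_erase univ (fun j => v i + 1 - v j) (mem_univ i)
    simp only [hk, sub_zero, add_sub_cancel_left, one_mul] at h1 h2
    rw [h1, h2]
  have heval : P.eval (v i) = (M - v i) * ∏ j ∈ univ.erase k, (v i + 1 - v j) := by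
    simp only [hP, eval_add, eval_sub, eval_mul, eval_X, eval_prod, eval_C]
    rw [hzero, add_zero]
    congr 1
    exact prod_congr rfl fun j _ => by ring
  rw [diffProd_update hv, heval, prod_div_distrib, ← hprod]
  field_simp [hv1 i]

theorem mem_partitionsOf {e n : ℕ} {lam : Fin e → ℕ} :
    lam ∈ partitionsOf e n ↔ Antitone lam ∧ ∑ i, lam i = n := by
  simp only [partitionsOf, mem_filter, Fintype.mem_piFinset, mem_range, Antitone]
  constructor
  · rintro ⟨-, h, hs⟩
    exact ⟨fun i j hij => h i j hij, hs⟩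
  · rintro ⟨h, hs⟩
    refine ⟨fun i => Nat.lt_succ_of_le ?_, fun i j hij => h hij, hs⟩
    exact hs ▸ single_le_sum (fun _ _ => Nat.zero_le _) (mem_univ i)

/-- The beta numbers (first column hook lengths) `λ_i + e - i` of a partition. -/
def betaNumber {e : ℕ} (lam : Fin e → ℕ) (i : Fin e) : ℚ := lam i + e - 1 - (i : ℕ)

theorem betaNumber_injective {e : ℕ} {lam : Fin e → ℕ} (h : Antitone lam) :
    Function.Injective (betaNumber lam) := by
  refine StrictAnti.injective fun i j hij => ?_
  have h1 : (lam j : ℚ) ≤ lam i := by exact_mod_cast h hij.le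
  have h2 : ((i : ℕ) : ℚ) < (j : ℕ) := by exact_mod_cast hij
  simp only [betaNumber]
  linarith

theorem cast_add_sub_eq_betaNumber {e : ℕ} (lam : Fin e → ℕ) (i : Fin e) :
    ((lam i + e - 1 - (i : ℕ) : ℕ) : ℚ) = betaNumber lam i := by
  have := i.isLt
  rw [betaNumber, Nat.cast_sub (by omega), Nat.cast_sub (by omega)]
  push_cast
  ring

theorem betaNumber_update {e : ℕ} (lam : Fin e → ℕ) (i : Fin e) (x : ℕ) :
    betaNumber (Function.update lam i x) =
      Function.update (betaNumber lam) i (betaNumber lam i + (x - lam i)) := by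
  ext j
  rcases eq_or_ne j i with rfl | hj
  · simp [betaNumber]
    ring
  · simp [betaNumber, hj]

theorem sum_betaNumber {e : ℕ} (lam : Fin e → ℕ) :
    ∑ i, betaNumber lam i = (∑ i, lam i : ℕ) + e * (e - 1) / 2 := by
  have h : ∑ i : Fin e, ((i : ℕ) : ℚ) = e * (e - 1) / 2 := by
    rw [Fin.sum_univ_eq_sum_range (fun i => (i : ℚ))]
    clear lam
    induction e with
    | zero => simp
    | succ e ih => rw [sum_range_succ, ih]; push_cast; ring
  simp only [betaNumber, sum_sub_distrib, sum_add_distrib, h]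
  simp
  ring

/-- `fSYT` divided by the factorial of the size. -/
def normalizedSYT {e : ℕ} (lam : Fin e → ℕ) : ℚ :=
  diffProd (betaNumber lam) / ∏ i : Fin e, ((lam i + e - 1 - (i : ℕ)).factorial : ℚ)

/-- Up to a constant depending only on `e` and `N`, the number of semistandard Young tableaux with
entries at most `N` whose shape is the conjugate of `lam`. -/
def normalizedSSYT {e : ℕ} (N : ℕ) (lam : Fin e → ℕ) : ℚ :=
  diffProd (betaNumber lam) / ∏ i : Fin e,
    (((lam i + e - 1 - (i : ℕ)).factorial : ℚ) * ((N + (i : ℕ) - lam i).factorial : ℚ))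

theorem prod_apply_update {ι R : Type*} [Fintype ι] [DecidableEq ι] [CommMonoid R]
    (F : ι → ℕ → R) (f : ι → ℕ) (i : ι) (x : ℕ) :
    ∏ j, F j (Function.update f i x j) = F i x * ∏ j ∈ univ.erase i, F j (f j) := by
  rw [← mul_prod_erase univ _ (mem_univ i), Function.update_self]
  congr 1
  exact prod_congr rfl fun j hj => by rw [Function.update_of_ne (ne_of_mem_erase hj)]

theorem sum_update {ι : Type*} [Fintype ι] [DecidableEq ι] (f : ι → ℕ) (i : ι) (x : ℕ) :
    ∑ j, Function.update f i x j + f i = ∑ j, f j + x := by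
  rw [← add_sum_erase univ _ (mem_univ i), ← add_sum_erase univ f (mem_univ i),
    Function.update_self, sum_congr rfl fun j hj => Function.update_of_ne (ne_of_mem_erase hj) x f]
  ring

theorem antitone_update_sub_one {e : ℕ} {lam : Fin e → ℕ} (h : Antitone lam) {i : Fin e}
    (hi : ∀ j : Fin e, (j : ℕ) = i + 1 → lam j ≠ lam i) :
    Antitone (Function.update lam i (lam i - 1)) := by
  intro a b hab
  have hle := h hab
  rcases eq_or_ne b i with rfl | hb
  · rw [Function.update_self]
    rcases eq_or_ne a b with rfl | ha
    · simp
    · rw [Function.update_of_ne ha]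
      omega
  · rw [Function.update_of_ne hb]
    rcases eq_or_ne a i with rfl | ha
    · have hab' : (a : ℕ) < b := lt_of_le_of_ne hab fun h => hb (Fin.ext h.symm)
      have hlt : (a : ℕ) + 1 < e := by omega
      have h1 := hi ⟨a + 1, hlt⟩ rfl
      have h2 : lam ⟨a + 1, hlt⟩ ≤ lam a := h (Fin.le_def.2 (by simp))
      have h3 : lam b ≤ lam ⟨a + 1, hlt⟩ := h (Fin.le_def.2 hab')
      rw [Function.update_self]
      omega
    · rwa [Function.update_of_ne ha]

theorem antitone_update_add_one {e : ℕ} {lam : Fin e → ℕ} (h : Antitone lam) {i : Fin e}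
    (hi : ∀ j : Fin e, (i : ℕ) = j + 1 → lam j ≠ lam i) :
    Antitone (Function.update lam i (lam i + 1)) := by
  intro a b hab
  have hle := h hab
  rcases eq_or_ne a i with rfl | ha
  · rw [Function.update_self]
    rcases eq_or_ne b a with rfl | hb
    · simp
    · rw [Function.update_of_ne hb]
      omega
  · rw [Function.update_of_ne ha]
    rcases eq_or_ne b i with rfl | hb
    · have hab' : (a : ℕ) < b := lt_of_le_of_ne hab fun h => ha (Fin.ext h)
      have hlt : (b : ℕ) - 1 < e := by omega
      have h1 := hi ⟨b - 1, hlt⟩ (by simp; omega)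
      have h2 : lam b ≤ lam ⟨b - 1, hlt⟩ := h (Fin.le_def.2 (by simp))
      have h3 : lam ⟨b - 1, hlt⟩ ≤ lam a := h (Fin.le_def.2 (by simp; omega))
      rw [Function.update_self]
      omega
    · rwa [Function.update_of_ne hb]

theorem sum_normalizedSYT_remove_box {e k : ℕ} {lam : Fin e → ℕ}
    (hlam : lam ∈ partitionsOf e (k + 1)) :
    (k + 1) * normalizedSYT lam =
      ∑ i, if 0 < lam i ∧ Function.update lam i (lam i - 1) ∈ partitionsOf e k then
        normalizedSYT (Function.update lam i (lam i - 1)) else 0 := by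
  obtain ⟨hanti, hsum⟩ := mem_partitionsOf.1 hlam
  have hid := sum_mul_diffProd_update_sub_one (betaNumber_injective hanti)
  rw [sum_betaNumber, hsum, add_sub_cancel_right] at hid
  rw [normalizedSYT, ← mul_div_assoc, ← Nat.cast_succ, ← hid, sum_div]
  refine sum_congr rfl fun i _ => ?_
  have hupd : 0 < lam i → betaNumber (Function.update lam i (lam i - 1)) =
      Function.update (betaNumber lam) i (betaNumber lam i - 1) := by
    intro hpos
    rw [betaNumber_update, Nat.cast_sub hpos]
    congr 1
    push_cast
    ring
  by_cases hj : ∃ j : Fin e, (j : ℕ) = i + 1 ∧ lam j = lam i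
  · obtain ⟨j, hj, hji⟩ := hj
    have hlt : i < j := Fin.lt_def.2 (by omega)
    have hzero : diffProd (Function.update (betaNumber lam) i (betaNumber lam i - 1)) = 0 := by
      refine diffProd_eq_zero hlt ?_
      rw [Function.update_self, Function.update_of_ne hlt.ne', betaNumber, betaNumber, hj, hji]
      push_cast
      ring
    rw [hzero, mul_zero, zero_div]
    split_ifs with hc
    · rw [normalizedSYT, hupd hc.1, hzero, zero_div]
    · rfl
  · push Not at hj
    rcases Nat.eq_zero_or_pos (lam i) with hi0 | hpos
    · have hlast : (i : ℕ) + 1 = e := by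
        by_contra hne
        have hlt : (i : ℕ) + 1 < e := by omega
        have h1 := hj ⟨i + 1, hlt⟩ rfl
        have h2 : lam ⟨i + 1, hlt⟩ ≤ lam i := hanti (Fin.le_def.2 (by simp))
        omega
      have hb : betaNumber lam i = 0 := by
        rw [← cast_add_sub_eq_betaNumber]
        exact_mod_cast (by omega : lam i + e - 1 - (i : ℕ) = 0)
      simp [hb, hi0]
    · have hmem : Function.update lam i (lam i - 1) ∈ partitionsOf e k := by
        refine mem_partitionsOf.2 ⟨antitone_update_sub_one hanti hj, ?_⟩
        have := sum_update lam i (lam i - 1)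
        omega
      rw [if_pos ⟨hpos, hmem⟩, normalizedSYT, hupd hpos,
        prod_apply_update (fun (j : Fin e) x => ((x + e - 1 - (j : ℕ)).factorial : ℚ)),
        ← mul_prod_erase univ _ (mem_univ i), ← cast_add_sub_eq_betaNumber]
      have hlt := i.isLt
      have hfac : lam i + e - 1 - (i : ℕ) = (lam i - 1 + e - 1 - (i : ℕ)) + 1 := by omega
      rw [hfac, Nat.factorial_succ, Nat.cast_mul, mul_assoc, mul_div_mul_left]
      exact Nat.cast_ne_zero.2 (Nat.succ_ne_zero _)

theorem sum_normalizedSSYT_add_box {e k N : ℕ} (hk : k < e) (hN : e ≤ N) {lam : Fin e → ℕ}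
    (hlam : lam ∈ partitionsOf e k) :
    N * normalizedSSYT N lam =
      ∑ i, if Function.update lam i (lam i + 1) ∈ partitionsOf e (k + 1) then
        normalizedSSYT N (Function.update lam i (lam i + 1)) else 0 := by
  obtain ⟨hanti, hsum⟩ := mem_partitionsOf.1 hlam
  have hle : ∀ i, lam i ≤ k := fun i =>
    hsum ▸ single_le_sum (fun _ _ => Nat.zero_le _) (mem_univ i)
  have hlast : lam ⟨e - 1, by omega⟩ = 0 := by
    by_contra hne
    have h1 : ∑ _i : Fin e, 1 ≤ ∑ i, lam i := sum_le_sum fun i _ =>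
      (Nat.one_le_iff_ne_zero.2 hne).trans (hanti (Fin.le_def.2 (by simp; omega)))
    simp at h1
    omega
  have hb : betaNumber lam ⟨e - 1, by omega⟩ = 0 := by
    rw [← cast_add_sub_eq_betaNumber, hlast]
    exact_mod_cast (by omega : 0 + e - 1 - (e - 1) = 0)
  have hb1 : ∀ i, betaNumber lam i + 1 ≠ 0 := fun i => by
    rw [← cast_add_sub_eq_betaNumber]
    positivity
  have hid := sum_mul_diffProd_update_add_one (betaNumber_injective hanti) hb1 hb (N + e - 1)
  rw [show (N + e - 1 + 1 - e : ℚ) = N by ring] at hid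
  rw [normalizedSSYT, ← mul_div_assoc, ← hid, sum_div]
  refine sum_congr rfl fun i _ => ?_
  have hupd : betaNumber (Function.update lam i (lam i + 1)) =
      Function.update (betaNumber lam) i (betaNumber lam i + 1) := by
    rw [betaNumber_update]
    congr 1
    push_cast
    ring
  by_cases hj : ∃ j : Fin e, (i : ℕ) = j + 1 ∧ lam j = lam i
  · obtain ⟨j, hj, hji⟩ := hj
    have hlt : j < i := Fin.lt_def.2 (by omega)
    have hzero : diffProd (Function.update (betaNumber lam) i (betaNumber lam i + 1)) = 0 := by
      refine diffProd_eq_zero hlt ?_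
      rw [Function.update_self, Function.update_of_ne hlt.ne, betaNumber, betaNumber, hj, hji]
      push_cast
      ring
    rw [hzero, mul_zero, zero_div, normalizedSSYT, hupd, hzero, zero_div, ite_self]
  · push Not at hj
    have hmem : Function.update lam i (lam i + 1) ∈ partitionsOf e (k + 1) := by
      refine mem_partitionsOf.2 ⟨antitone_update_add_one hanti hj, ?_⟩
      have := sum_update lam i (lam i + 1)
      omega
    have hlt := i.isLt
    have hi := hle i
    have hfac1 : lam i + 1 + e - 1 - (i : ℕ) = (lam i + e - 1 - (i : ℕ)) + 1 := by omega
    have hfac2 : N + (i : ℕ) - lam i = (N + (i : ℕ) - (lam i + 1)) + 1 := by omega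
    have hcast : (N + e - 1 : ℚ) - betaNumber lam i = ((N + (i : ℕ) - (lam i + 1) + 1 : ℕ) : ℚ) := by
      rw [← hfac2, Nat.cast_sub (by omega), betaNumber]
      push_cast
      ring
    rw [if_pos hmem, normalizedSSYT, hupd,
      prod_apply_update (fun (j : Fin e) x => ((x + e - 1 - (j : ℕ)).factorial : ℚ) *
        ((N + (j : ℕ) - x).factorial : ℚ)),
      ← mul_prod_erase univ _ (mem_univ i), hcast, hfac1, hfac2, Nat.factorial_succ,
      Nat.factorial_succ, Nat.cast_mul, Nat.cast_mul, Nat.cast_succ (lam i + e - 1 - (i : ℕ)),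
      cast_add_sub_eq_betaNumber]
    have h1 := hb1 i
    have h2 : ((N + (i : ℕ) - (lam i + 1) + 1 : ℕ) : ℚ) ≠ 0 := by positivity
    field_simp

theorem succ_mul_sum_partitionsOf_succ {e k N : ℕ} (hk : k < e) (hN : e ≤ N) :
    (k + 1) * ∑ lam ∈ partitionsOf e (k + 1), normalizedSYT lam * normalizedSSYT N lam =
      N * ∑ lam ∈ partitionsOf e k, normalizedSYT lam * normalizedSSYT N lam := by
  have hL : ∀ lam ∈ partitionsOf e (k + 1),
      (k + 1) * (normalizedSYT lam * normalizedSSYT N lam) =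
      ∑ i, if 0 < lam i ∧ Function.update lam i (lam i - 1) ∈ partitionsOf e k then
        normalizedSYT (Function.update lam i (lam i - 1)) * normalizedSSYT N lam else 0 := by
    intro lam hlam
    rw [← mul_assoc, sum_normalizedSYT_remove_box hlam, sum_mul]
    simp_rw [ite_mul, zero_mul]
  have hR : ∀ lam ∈ partitionsOf e k,
      N * (normalizedSYT lam * normalizedSSYT N lam) =
      ∑ i, if Function.update lam i (lam i + 1) ∈ partitionsOf e (k + 1) then
        normalizedSYT lam * normalizedSSYT N (Function.update lam i (lam i + 1)) else 0 := by
    intro lam hlam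
    rw [mul_left_comm, sum_normalizedSSYT_add_box hk hN hlam, mul_sum]
    simp_rw [mul_ite, mul_zero]
  rw [mul_sum, mul_sum, sum_congr rfl hL, sum_congr rfl hR, sum_comm]
  conv_rhs => rw [sum_comm]
  refine sum_congr rfl fun i _ => ?_
  rw [← sum_filter, ← sum_filter]
  have hcancel : ∀ lam : Fin e → ℕ, 0 < lam i → Function.update lam i (lam i - 1 + 1) = lam :=
    fun lam h => by rw [Nat.sub_add_cancel h, Function.update_eq_self]
  refine sum_bij' (fun lam _ => Function.update lam i (lam i - 1))
    (fun lam _ => Function.update lam i (lam i + 1)) ?_ ?_ ?_ ?_ ?_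
  · intro lam h
    obtain ⟨h1, h2, h3⟩ := mem_filter.1 h
    simp [h3, hcancel lam h2, h1]
  · intro lam h
    obtain ⟨h1, h2⟩ := mem_filter.1 h
    simp [h1, h2]
  · intro lam h
    simp [hcancel lam (mem_filter.1 h).2.1]
  · intro lam h
    simp
  · intro lam h
    simp [hcancel lam (mem_filter.1 h).2.1]

theorem sum_normalizedSYT_mul_normalizedSSYT {e k N : ℕ} (hk : k ≤ e) (hN : e ≤ N) :
    ∑ lam ∈ partitionsOf e k, normalizedSYT lam * normalizedSSYT N lam =
      N ^ k / k.factorial * (normalizedSYT (0 : Fin e → ℕ) * normalizedSSYT N (0 : Fin e → ℕ)) := by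
  induction k with
  | zero =>
    have : partitionsOf e 0 = {0} := by
      ext lam
      rw [mem_partitionsOf, mem_singleton]
      constructor
      · rintro ⟨-, h⟩
        ext i
        simpa using (sum_eq_zero_iff.1 h) i (mem_univ i)
      · rintro rfl
        exact ⟨fun _ _ _ => le_rfl, by simp⟩
    simp [this]
  | succ k ih =>
    have h := succ_mul_sum_partitionsOf_succ (k := k) hk hN
    rw [ih (by omega)] at h
    have hk1 : (k + 1 : ℚ) ≠ 0 := by positivity
    rw [← mul_right_inj' hk1, h, Nat.factorial_succ, pow_succ]
    push_cast
    field_simp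

theorem diffProd_betaNumber_zero (e : ℕ) :
    diffProd (betaNumber (0 : Fin e → ℕ)) = ∏ i : Fin e, ((e - 1 - (i : ℕ)).factorial : ℚ) := by
  induction e with
  | zero => simp [diffProd]
  | succ e ih =>
    rw [diffProd, Fin.prod_univ_succ, Fin.prod_univ_succ]
    congr 1
    · rw [Fin.Ioi_zero_eq_map, prod_map]
      have h : ∀ i : Fin e, betaNumber (0 : Fin (e + 1) → ℕ) 0 -
          betaNumber (0 : Fin (e + 1) → ℕ) (Fin.succEmb e i) = ((i + 1 : ℕ) : ℚ) := fun i => by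
        simp [betaNumber]
      rw [prod_congr rfl fun i _ => h i, Fin.prod_univ_eq_prod_range (fun i => ((i + 1 : ℕ) : ℚ)),
        ← Nat.cast_prod, prod_range_add_one_eq_factorial]
      simp
    · rw [diffProd] at ih
      simp only [Fin.Ioi_succ, prod_map]
      convert ih using 3
      · simp [betaNumber]
      · rw [Fin.val_succ, Nat.add_sub_cancel, Nat.sub_sub, add_comm 1]

theorem normalizedSYT_zero (e : ℕ) : normalizedSYT (0 : Fin e → ℕ) = 1 := by
  rw [normalizedSYT, diffProd_betaNumber_zero]
  simp only [Pi.zero_apply, zero_add]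
  exact div_self (prod_ne_zero_iff.2 fun i _ => by positivity)

theorem fSYT_eq {e : ℕ} (lam : Fin e → ℕ) :
    fSYT e lam = ((∑ i, lam i).factorial : ℚ) * normalizedSYT lam := by
  rw [fSYT, normalizedSYT, diffProd, mul_div_assoc]
  have h : ∀ i j : Fin e, (lam i : ℚ) - lam j + (j : ℕ) - (i : ℕ) =
      betaNumber lam i - betaNumber lam j := fun i j => by
    simp only [betaNumber]
    ring
  simp_rw [h]

theorem normalizedSSYT_eq {e : ℕ} (N : ℕ) (lam : Fin e → ℕ) :
    normalizedSSYT N lam =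
      normalizedSYT lam / ∏ i : Fin e, ((N + (i : ℕ) - lam i).factorial : ℚ) := by
  rw [normalizedSSYT, normalizedSYT, prod_mul_distrib, div_div]

/-- Corollary 2.8: for every positive integer n, the sum over all partitions
lam = (lam_1, ..., lam_n) of n (with at most n parts) of
(f^lam)^2 * prod_{i=1}^{n} (n+i)!/(n+i-lam_i)! equals (n+1)^n * n!. -/
theorem sum_fSYT_sq_eq (n : ℕ) (hn : 0 < n) :
    ∑ lam ∈ partitionsOf n n,
      (fSYT n lam) ^ 2 *
        ∏ i : Fin n,
          ((n + ((i : ℕ) + 1)).factorial : ℚ) /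
            ((n + ((i : ℕ) + 1) - lam i).factorial : ℚ)
      = ((n + 1 : ℕ) : ℚ) ^ n * (n.factorial : ℚ) := by
  have hmain := sum_normalizedSYT_mul_normalizedSSYT (e := n) (k := n) (N := n + 1) le_rfl
    n.le_succ
  have hterm : ∀ lam ∈ partitionsOf n n, (fSYT n lam) ^ 2 * ∏ i : Fin n,
      ((n + ((i : ℕ) + 1)).factorial : ℚ) / ((n + ((i : ℕ) + 1) - lam i).factorial : ℚ) =
      (n.factorial : ℚ) ^ 2 * (∏ i : Fin n, ((n + ((i : ℕ) + 1)).factorial : ℚ)) *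
        (normalizedSYT lam * normalizedSSYT (n + 1) lam) := by
    intro lam hlam
    rw [fSYT_eq, (mem_partitionsOf.1 hlam).2, normalizedSSYT_eq, prod_div_distrib]
    simp only [add_right_comm n 1, ← add_assoc]
    ring
  rw [sum_congr rfl hterm, ← mul_sum, hmain, normalizedSSYT_eq, normalizedSYT_zero]
  have hne : (∏ i : Fin n, ((n + ((i : ℕ) + 1)).factorial : ℚ)) ≠ 0 :=
    prod_ne_zero_iff.2 fun i _ => by positivity
  have hfac : (n.factorial : ℚ) ≠ 0 := by positivity
  simp only [add_right_comm n 1, ← add_assoc, Pi.zero_apply, Nat.sub_zero] at hne ⊢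
  field_simp
end

section
/- Let n ≥ 0 and e ≥ 1 be integers and let λ = (λ_1 ≥ … ≥ λ_e ≥ 0) be a partition with λ_1 ≤ n + 1. Then the determinant of the e × e matrix over ℚ whose (i,j) entry is the binomial coefficient C(n+1, λ_i + j − i) (interpreted as 0 when λ_i + j − i < 0 or λ_i + j − i > n + 1) equals (f^λ / |λ|!) · ∏_{i=1}^{e} (n+i)! / (n+i−λ_i)!. -/
open Finset

/-- The determinant of falling factorials, with the highest powers in the first column. -/
lemma det_descFactorial_rev {e : ℕ} (m : Fin e → ℕ) :
    Matrix.det (Matrix.of fun i j : Fin e => ((m i).descFactorial (j.rev : ℕ) : ℚ)) =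
      ∏ i : Fin e, ∏ j ∈ Finset.Ioi i, ((m i : ℚ) - (m j : ℚ)) := by
  rw [← Matrix.det_submatrix_equiv_self Fin.revPerm]
  have h := Matrix.det_eval_matrixOfPolynomials_eq_det_vandermonde
    (fun i : Fin e => (m i.rev : ℚ)) (fun j => descPochhammer ℚ (j : ℕ))
    (fun j => descPochhammer_natDegree ℚ _) (fun j => monic_descPochhammer ℚ _)
  have hM : (Matrix.of fun i j : Fin e => ((m i).descFactorial (j.rev : ℕ) : ℚ)).submatrix
      Fin.revPerm Fin.revPerm =
      Matrix.of fun i j : Fin e => (descPochhammer ℚ (j : ℕ)).eval (m i.rev : ℚ) := by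
    ext i j
    simp only [Matrix.submatrix_apply, Matrix.of_apply, Fin.revPerm_apply, Fin.rev_rev,
      descPochhammer_eval_eq_descFactorial]
  rw [hM, ← h, Matrix.det_vandermonde]
  have hIoi (f : Fin e → Fin e → ℚ) :
      ∏ i, ∏ j ∈ Finset.Ioi i, f i j = ∏ i, ∏ j, if i < j then f i j else 1 := by
    refine Finset.prod_congr rfl fun i _ => ?_
    rw [← Finset.prod_filter]
    congr 1
    ext j
    simp
  rw [hIoi, hIoi, Finset.prod_comm, ← Equiv.prod_comp Fin.revPerm]
  refine Finset.prod_congr rfl fun i _ => ?_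
  rw [← Equiv.prod_comp Fin.revPerm]
  simp

/-- A form of the Vandermonde convolution for binomial coefficients with lower index `s - r`,
read as zero when `s < r`. -/
lemma sum_choose_mul_choose_sub (N r : ℕ) (j a : ℕ) :
    ∑ k ∈ Finset.range (j + 1),
        (if r ≤ a + k then (N.choose (a + k - r) : ℚ) else 0) * (j.choose k : ℚ) =
      if r ≤ a + j then ((N + j).choose (a + j - r) : ℚ) else 0 := by
  induction j generalizing a with
  | zero => simp
  | succ j ih =>
    have hpascal : (if r ≤ a + (j + 1) then ((N + (j + 1)).choose (a + (j + 1) - r) : ℚ) else 0) =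
        (if r ≤ a + j then ((N + j).choose (a + j - r) : ℚ) else 0) +
          if r ≤ a + 1 + j then ((N + j).choose (a + 1 + j - r) : ℚ) else 0 := by
      rcases lt_trichotomy r (a + j + 1) with h | h | h
      · rw [if_pos (by omega), if_pos (by omega), if_pos (by omega),
          show a + (j + 1) - r = (a + j - r) + 1 by omega,
          show a + 1 + j - r = (a + j - r) + 1 by omega, ← add_assoc, Nat.choose_succ_succ]
        push_cast
        rfl
      · rw [if_pos (by omega), if_neg (by omega), if_pos (by omega),
          show a + (j + 1) - r = 0 by omega, show a + 1 + j - r = 0 by omega]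
        simp
      · rw [if_neg (by omega), if_neg (by omega), if_neg (by omega), add_zero]
    rw [hpascal, ← ih a, ← ih (a + 1), Finset.sum_range_succ',
      Finset.sum_range_succ' (fun k =>
        (if r ≤ a + k then (N.choose (a + k - r) : ℚ) else 0) * (j.choose k : ℚ)) j]
    simp only [Nat.choose_succ_succ, Nat.cast_add, mul_add, Finset.sum_add_distrib]
    rw [Finset.sum_range_succ (fun k =>
      (if r ≤ a + (k + 1) then (N.choose (a + (k + 1) - r) : ℚ) else 0) *
        (j.choose (k + 1) : ℚ))]
    simp only [Nat.choose_succ_self, Nat.cast_zero, mul_zero, add_zero, Nat.choose_zero_right,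
      show ∀ k, a + 1 + k = a + (k + 1) from fun k => by omega]
    ring

/-- Column operations raise the upper index of the binomial coefficients in column `j` by `j`. -/
lemma det_choose_eq_det_choose_add (N e : ℕ) (lam : Fin e → ℕ) :
    Matrix.det (Matrix.of fun i j : Fin e =>
      if (i : ℕ) ≤ lam i + (j : ℕ) then (N.choose (lam i + (j : ℕ) - (i : ℕ)) : ℚ) else 0) =
    Matrix.det (Matrix.of fun i j : Fin e =>
      if (i : ℕ) ≤ lam i + (j : ℕ) then
        ((N + (j : ℕ)).choose (lam i + (j : ℕ) - (i : ℕ)) : ℚ) else 0) := by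
  let U : Matrix (Fin e) (Fin e) ℚ := Matrix.of fun k j => ((j : ℕ).choose (k : ℕ) : ℚ)
  have hU : U.det = 1 := by
    rw [Matrix.det_of_isUpperTriangular]
    · simp [U]
    · intro i j hij
      simp only [U, Matrix.of_apply, Nat.cast_eq_zero]
      exact Nat.choose_eq_zero_of_lt hij
  rw [← mul_one (Matrix.det _), ← hU, ← Matrix.det_mul]
  congr 1
  ext i j
  simp only [Matrix.mul_apply, U, Matrix.of_apply]
  rw [← sum_choose_mul_choose_sub, Fin.sum_univ_eq_sum_range (fun k =>
    (if (i : ℕ) ≤ lam i + k then (N.choose (lam i + k - (i : ℕ)) : ℚ) else 0) *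
      ((j : ℕ).choose k : ℚ)) e]
  refine (Finset.sum_subset (Finset.range_mono j.isLt) fun k _ hk => ?_).symm
  rw [Nat.choose_eq_zero_of_lt (show (j : ℕ) < k by simpa using hk), Nat.cast_zero, mul_zero]

/-- Writing a binomial coefficient with lower index `a + j - i` as a falling factorial of
`a + e - 1 - i`, up to factors depending on only one of the two indices `i`, `j`. -/
lemma choose_sub_eq_descFactorial {N e a i j : ℕ} (hi : i < e) (hj : j < e) (ha : a ≤ N) :
    (if i ≤ a + j then ((N + j).choose (a + j - i) : ℚ) else 0) =
      (1 / (((a + e - 1 - i).factorial : ℚ) * ((N + i - a).factorial : ℚ))) *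
        (((N + j).factorial : ℚ) * ((a + e - 1 - i).descFactorial (e - (j + 1)) : ℚ)) := by
  split_ifs with h
  · have h1 := Nat.factorial_mul_descFactorial (n := a + e - 1 - i) (k := e - (j + 1)) (by omega)
    rw [show a + e - 1 - i - (e - (j + 1)) = a + j - i by omega] at h1
    rcases le_or_gt (a + j - i) (N + j) with h2 | h2
    · have h3 := Nat.choose_mul_factorial_mul_factorial h2
      rw [show N + j - (a + j - i) = N + i - a by omega] at h3
      rw [← h1, ← h3]
      have := Nat.descFactorial_pos.2 (show e - (j + 1) ≤ a + e - 1 - i by omega)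
      push_cast
      field_simp
    · omega
  · rw [Nat.descFactorial_of_lt (by omega)]
    simp

/-- Let n >= 0, e >= 1 and let lam = (lam_1 >= ... >= lam_e >= 0) be a partition
with lam_1 <= n + 1.  Then the determinant of the e x e matrix over ℚ whose
(i,j) entry is the binomial coefficient C(n+1, lam_i + j - i) (zero when
lam_i + j - i < 0 or > n + 1) equals
(f^lam / |lam|!) * prod_{i=1}^{e} (n+i)!/(n+i-lam_i)!. -/
theorem det_binomial_eq (n e : ℕ) (he : 1 ≤ e) (lam : Fin e → ℕ)
    (hdec : ∀ i j : Fin e, i ≤ j → lam j ≤ lam i)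
    (h1 : lam ⟨0, he⟩ ≤ n + 1) :
    Matrix.det (Matrix.of fun i j : Fin e =>
      if (i : ℕ) ≤ lam i + (j : ℕ) then
        ((n + 1).choose (lam i + (j : ℕ) - (i : ℕ)) : ℚ)
      else 0)
    = fSYT e lam / ((∑ i, lam i).factorial : ℚ) *
        ∏ i : Fin e,
          ((n + ((i : ℕ) + 1)).factorial : ℚ) /
            ((n + ((i : ℕ) + 1) - lam i).factorial : ℚ) := by
  have hle (i : Fin e) : lam i ≤ n + 1 := (hdec ⟨0, he⟩ i (Nat.zero_le _)).trans h1
  have hM : (Matrix.of fun i j : Fin e =>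
      if (i : ℕ) ≤ lam i + (j : ℕ) then
        ((n + 1 + (j : ℕ)).choose (lam i + (j : ℕ) - (i : ℕ)) : ℚ) else 0) =
      Matrix.of fun i j : Fin e =>
        (1 / (((lam i + e - 1 - i).factorial : ℚ) * ((n + 1 + i - lam i).factorial : ℚ))) *
        (Matrix.of fun i j : Fin e => ((n + 1 + (j : ℕ)).factorial : ℚ) *
          (Matrix.of fun i j : Fin e =>
            ((lam i + e - 1 - i).descFactorial (j.rev : ℕ) : ℚ)) i j) i j := by
    ext i j
    simp only [Matrix.of_apply, Fin.val_rev]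
    exact choose_sub_eq_descFactorial i.isLt j.isLt (hle i)
  have hdiff : ∏ i : Fin e, ∏ j ∈ Finset.Ioi i,
        (((lam i + e - 1 - i : ℕ) : ℚ) - ((lam j + e - 1 - j : ℕ) : ℚ)) =
      ∏ i : Fin e, ∏ j ∈ Finset.Ioi i,
        ((lam i : ℚ) - (lam j : ℚ) + ((j : ℕ) : ℚ) - ((i : ℕ) : ℚ)) := by
    have hcast (i : Fin e) : ((lam i + e - 1 - i : ℕ) : ℚ) = lam i + e - 1 - (i : ℕ) := by
      rw [Nat.cast_sub (by omega), Nat.cast_sub (by omega)]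
      push_cast
      rfl
    refine Finset.prod_congr rfl fun i _ => Finset.prod_congr rfl fun j _ => ?_
    rw [hcast, hcast]
    ring
  rw [det_choose_eq_det_choose_add, hM, Matrix.det_mul_column, Matrix.det_mul_row,
    det_descFactorial_rev, hdiff, fSYT]
  have hidx (i : Fin e) : n + ((i : ℕ) + 1) = n + 1 + i := by omega
  simp only [hidx, Finset.prod_div_distrib, Finset.prod_mul_distrib, Finset.prod_const_one]
  have hfac := Nat.factorial_ne_zero (∑ i, lam i)
  have hprod (f : Fin e → ℕ) : ∏ i, ((f i).factorial : ℚ) ≠ 0 :=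
    Finset.prod_ne_zero_iff.2 fun i _ => Nat.cast_ne_zero.2 (Nat.factorial_ne_zero _)
  have h2 := hprod fun i => lam i + e - 1 - i
  have h3 := hprod fun i => n + 1 + i - lam i
  field_simp
end

section
/- Let n ≥ 1 and m, N be integers with n ≤ m ≤ N − 1 and N ≥ 2n. Then for every partition λ = (λ_1, …, λ_n) of n with at most n parts, the rational number D(λ) satisfies ∏_{i=1}^{n} (N − m + 1 − i)/(N − n + 1 − i) ≤ D(λ) ≤ ∏_{l=1}^{n} (N − m + l − 1)/(N − n + l − 1); that is, D((1^n)) ≤ D(λ) ≤ D((n)), where (1^n) is the partition of n into n parts equal to 1 and (n) is the partition with the single part n. -/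
open Finset

/-- For integers n >= 1, m, N with n <= m <= N - 1 and N >= 2n, and a tuple
lam = (lam_1, ..., lam_n) (0-indexed as lam : Fin n → ℕ), the rational number
D(lam) := prod_{1<=i<=n} prod_{1<=l<=lam_i} (N - m + l - i)/(N - n + l - i). -/
def Dfun (n m N : ℕ) (lam : Fin n → ℕ) : ℚ :=
  ∏ i : Fin n, ∏ l ∈ Finset.range (lam i),
    ((N : ℚ) - m + l - (i : ℕ)) / ((N : ℚ) - n + l - (i : ℕ))

theorem prod_range_prod_range_partialSum (h : ℕ → ℚ) (lam : ℕ → ℕ) (r : ℕ) :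
    ∏ i ∈ range r, ∏ l ∈ range (lam i), h (∑ j ∈ range i, lam j + l)
      = ∏ k ∈ range (∑ j ∈ range r, lam j), h k := by
  induction r with
  | zero => simp
  | succ r ih => rw [prod_range_succ, ih, sum_range_succ, prod_range_add]

/-- If negative factors only occur alongside a zero factor, every factor may be replaced by its
positive part. -/
theorem prod_eq_prod_max_zero {ι : Type*} (s : Finset ι) (f : ι → ℚ)
    (h : ∀ x ∈ s, f x < 0 → ∃ y ∈ s, f y = 0) : ∏ x ∈ s, f x = ∏ x ∈ s, max 0 (f x) := by
  by_cases hneg : ∃ x ∈ s, f x < 0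
  · obtain ⟨x, hx, hfx⟩ := hneg
    obtain ⟨y, hy, hfy⟩ := h x hx hfx
    rw [prod_eq_zero hy hfy, prod_eq_zero hy (by rw [hfy, max_self])]
  · push Not at hneg
    exact prod_congr rfl fun x hx => (max_eq_right (hneg x hx)).symm

theorem add_div_add_le_add_div_add {a b c d : ℚ} (hab : a ≤ b) (hc : 0 < b + c) (hcd : c ≤ d) :
    (a + c) / (b + c) ≤ (a + d) / (b + d) := by
  rw [div_le_div_iff₀ hc (by linarith)]
  nlinarith [mul_nonneg (sub_nonneg.2 hab) (sub_nonneg.2 hcd)]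

theorem le_sum_range_of_antitone {lam : ℕ → ℕ} (hlam : Antitone lam) {i : ℕ} (hi : 0 < lam i) :
    i ≤ ∑ j ∈ range i, lam j := by
  simpa using card_nsmul_le_sum (range i) lam 1
    fun j hj => hi.trans_le (hlam (mem_range.1 hj).le)

theorem prod_content_bounds (n a : ℕ) (b : ℚ) (hab : (a : ℚ) ≤ b) (hb : (n : ℚ) ≤ b)
    (lam : ℕ → ℕ) (hlam : Antitone lam) (hsum : ∑ i ∈ range n, lam i = n) :
    (∏ k ∈ range n, ((a : ℚ) - k) / (b - k)) ≤
        ∏ i ∈ range n, ∏ l ∈ range (lam i), ((a : ℚ) + l - i) / (b + l - i)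
    ∧ ∏ i ∈ range n, ∏ l ∈ range (lam i), ((a : ℚ) + l - i) / (b + l - i) ≤
        ∏ k ∈ range n, ((a : ℚ) + k) / (b + k) := by
  have hpos : ∀ i < n, ∀ l : ℕ, 0 < b + l - i := fun i hi l => by
    have : (i : ℚ) < n := by exact_mod_cast hi
    have : (0 : ℚ) ≤ l := l.cast_nonneg
    linarith
  have hD : ∏ i ∈ range n, ∏ l ∈ range (lam i), ((a : ℚ) + l - i) / (b + l - i) =
      ∏ i ∈ range n, ∏ l ∈ range (lam i), max 0 (((a : ℚ) + l - i) / (b + l - i)) := by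
    rw [prod_sigma', prod_sigma']
    refine prod_eq_prod_max_zero _ _ ?_
    rintro ⟨i, l⟩ hx hneg
    simp only [mem_sigma, mem_range] at hx hneg
    rw [div_lt_iff₀ (hpos i hx.1 l), zero_mul] at hneg
    have hai : a < i := by
      have : (a : ℚ) < i := by linarith [(l.cast_nonneg : (0 : ℚ) ≤ l)]
      exact_mod_cast this
    refine ⟨⟨a, 0⟩, ?_, by simp⟩
    simp only [mem_sigma, mem_range]
    exact ⟨hai.trans hx.1, (Nat.zero_lt_of_lt hx.2).trans_le (hlam hai.le)⟩
  have hL : ∏ k ∈ range n, ((a : ℚ) - k) / (b - k) =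
      ∏ k ∈ range n, max 0 (((a : ℚ) - k) / (b - k)) := by
    refine prod_eq_prod_max_zero _ _ fun k hk hneg => ⟨a, ?_, by simp⟩
    have hp := hpos k (mem_range.1 hk) 0
    rw [Nat.cast_zero, add_zero] at hp
    rw [div_lt_iff₀ hp, zero_mul, sub_neg] at hneg
    exact mem_range.2 (lt_trans (by exact_mod_cast hneg) (mem_range.1 hk))
  have hindex : ∀ i ∈ range n, ∀ l ∈ range (lam i), ∑ j ∈ range i, lam j + l < n := by
    intro i hi l hl
    have := sum_le_sum_of_subset (f := lam) (range_subset_range.2 (mem_range.1 hi))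
    rw [sum_range_succ, hsum] at this
    have := mem_range.1 hl
    omega
  constructor
  · have key := prod_range_prod_range_partialSum
      (fun k => max 0 (((a : ℚ) - k) / (b - k))) lam n
    rw [hsum] at key
    rw [hL, hD, ← key]
    refine prod_le_prod (fun _ _ => prod_nonneg fun _ _ => le_max_left _ _) fun i hi =>
      prod_le_prod (fun _ _ => le_max_left _ _) fun l hl => max_le_max le_rfl ?_
    have hp := hpos _ (hindex i hi l hl) 0
    have hi' : (i : ℚ) ≤ (∑ j ∈ range i, lam j : ℕ) := by
      exact_mod_cast le_sum_range_of_antitone hlam (Nat.zero_lt_of_lt (mem_range.1 hl))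
    have hl0 : (0 : ℚ) ≤ l := l.cast_nonneg
    rw [Nat.cast_zero, add_zero] at hp
    rw [add_sub_assoc, add_sub_assoc, sub_eq_add_neg (a : ℚ), sub_eq_add_neg b]
    refine add_div_add_le_add_div_add hab (by linarith) ?_
    rw [Nat.cast_add]
    linarith
  · have hU : ∏ k ∈ range n, ((a : ℚ) + k) / (b + k) =
        ∏ k ∈ range n, max 0 (((a : ℚ) + k) / (b + k)) := by
      have hb0 : 0 ≤ b := n.cast_nonneg.trans hb
      exact prod_congr rfl fun k _ => (max_eq_right (by positivity)).symm
    have key := prod_range_prod_range_partialSum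
      (fun k => max 0 (((a : ℚ) + k) / (b + k))) lam n
    rw [hsum] at key
    rw [hU, hD, ← key]
    refine prod_le_prod (fun _ _ => prod_nonneg fun _ _ => le_max_left _ _) fun i hi =>
      prod_le_prod (fun _ _ => le_max_left _ _) fun l hl => max_le_max le_rfl ?_
    have hp := hpos i (mem_range.1 hi) l
    have hs : (0 : ℚ) ≤ (∑ j ∈ range i, lam j : ℕ) := Nat.cast_nonneg _
    have hi0 : (0 : ℚ) ≤ i := i.cast_nonneg
    rw [add_sub_assoc, add_sub_assoc]
    refine add_div_add_le_add_div_add hab (by linarith) ?_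
    rw [Nat.cast_add]
    linarith

/-- Lemma 2.9 (bounds on D): for n >= 1, n <= m <= N - 1, N >= 2n and every
partition lam of n with at most n parts,
D((1^n)) = prod_{i=1}^{n} (N-m+1-i)/(N-n+1-i) <= D(lam)
<= prod_{l=1}^{n} (N-m+l-1)/(N-n+l-1) = D((n)). -/
theorem Dfun_bounds (n m N : ℕ) (hn : 0 < n) (hnm : n ≤ m) (hmN : m + 1 ≤ N)
    (hN : 2 * n ≤ N) (lam : Fin n → ℕ)
    (hdec : ∀ i j : Fin n, i ≤ j → lam j ≤ lam i)
    (hsum : ∑ i, lam i = n) :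
    (∏ i ∈ Finset.range n, ((N : ℚ) - m - i) / ((N : ℚ) - n - i)) ≤ Dfun n m N lam
    ∧ Dfun n m N lam ≤ ∏ l ∈ Finset.range n, ((N : ℚ) - m + l) / ((N : ℚ) - n + l) := by
  have hlam : Antitone fun i : ℕ => if h : i < n then lam ⟨i, h⟩ else 0 := by
    intro i j hij
    by_cases hj : j < n
    · simpa [hj, hij.trans_lt hj] using hdec ⟨i, hij.trans_lt hj⟩ ⟨j, hj⟩ hij
    · simp [hj]
  have hab : ((N - m : ℕ) : ℚ) ≤ (N : ℚ) - n := by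
    rw [Nat.cast_sub (by omega)]
    have : (n : ℚ) ≤ m := by exact_mod_cast hnm
    linarith
  have hb : (n : ℚ) ≤ (N : ℚ) - n := by
    have : (2 : ℚ) * n ≤ N := by exact_mod_cast hN
    linarith
  have h := prod_content_bounds n (N - m) (N - n) hab hb _ hlam (by
    rw [sum_range]
    simpa using hsum)
  rw [prod_range (n := n)
    (f := fun i => ∏ l ∈ range (if h : i < n then lam ⟨i, h⟩ else 0), _)] at h
  simpa [Dfun, Nat.cast_sub (show m ≤ N by omega)] using h
end

section
/- Let n ≥ 1 and m, N be integers with n ≤ m ≤ N − 1 and N ≥ 2n. Let λ = (λ_1, …, λ_n) be a partition of n whose nonzero parts all occur in the first N − m positions (λ_k = 0 for every k > N − m), let 1 ≤ i < j ≤ n be indices with λ_i > λ_j, and suppose that the tuple μ obtained from λ by replacing λ_i with λ_i − 1 and λ_j with λ_j + 1 is again weakly decreasing with all nonzero parts in the first N − m positions. Then D(λ) ≥ D(μ). -/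
open Finset

/-- Adding a box at the end of row `k` multiplies `Dfun` by the factor of that box. -/
theorem Dfun_update_succ (n m N : ℕ) (lam : Fin n → ℕ) (k : Fin n) :
    Dfun n m N (Function.update lam k (lam k + 1)) =
      Dfun n m N lam *
        (((N : ℚ) - m + lam k - (k : ℕ)) / ((N : ℚ) - n + lam k - (k : ℕ))) := by
  unfold Dfun
  rw [← Finset.mul_prod_erase _ _ (Finset.mem_univ k),
    ← Finset.mul_prod_erase Finset.univ
      (fun i : Fin n => ∏ l ∈ Finset.range (lam i),
        ((N : ℚ) - m + l - (i : ℕ)) / ((N : ℚ) - n + l - (i : ℕ))) (Finset.mem_univ k),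
    Function.update_self, Finset.prod_range_succ]
  have hrest : ∏ i ∈ Finset.univ.erase k,
      ∏ l ∈ Finset.range (Function.update lam k (lam k + 1) i),
        ((N : ℚ) - m + l - (i : ℕ)) / ((N : ℚ) - n + l - (i : ℕ)) =
      ∏ i ∈ Finset.univ.erase k, ∏ l ∈ Finset.range (lam i),
        ((N : ℚ) - m + l - (i : ℕ)) / ((N : ℚ) - n + l - (i : ℕ)) :=
    Finset.prod_congr rfl fun i hi => by
      rw [Function.update_of_ne (Finset.ne_of_mem_erase hi)]
  rw [hrest]
  ring

/-- `Dfun` is nonnegative on tuples supported in the first `N - m` positions. -/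
theorem Dfun_nonneg (n m N : ℕ) (hN : 2 * n ≤ N) (lam : Fin n → ℕ)
    (hsupp : ∀ k : Fin n, N - m ≤ (k : ℕ) → lam k = 0) : 0 ≤ Dfun n m N lam := by
  refine Finset.prod_nonneg fun k _ => Finset.prod_nonneg fun l hl => ?_
  have hl' := Finset.mem_range.mp hl
  have hk : (k : ℕ) + m ≤ N := by
    by_contra h
    have := hsupp k (by omega)
    omega
  have hkn : (k : ℕ) + n ≤ N := by omega
  have hk' : ((k : ℕ) : ℚ) + m ≤ N := by exact_mod_cast hk
  have hkn' : ((k : ℕ) : ℚ) + n ≤ N := by exact_mod_cast hkn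
  have hl0 : (0 : ℚ) ≤ l := Nat.cast_nonneg l
  exact div_nonneg (by linarith) (by linarith)

/-- The key monotonicity step in Lemma 2.9: if lam is a partition of n with all
nonzero parts among the first N - m positions, lam_i > lam_j for some i < j, and
the tuple mu obtained by replacing lam_i with lam_i - 1 and lam_j with lam_j + 1
is again weakly decreasing with all nonzero parts among the first N - m
positions, then D(lam) >= D(mu). -/
theorem Dfun_antitone_step (n m N : ℕ) (hn : 0 < n) (hnm : n ≤ m)
    (hmN : m + 1 ≤ N) (hN : 2 * n ≤ N) (lam : Fin n → ℕ)
    (hdec : ∀ i j : Fin n, i ≤ j → lam j ≤ lam i)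
    (hsum : ∑ i, lam i = n)
    (hsupp : ∀ k : Fin n, N - m ≤ (k : ℕ) → lam k = 0)
    (i j : Fin n) (hij : i < j) (hgt : lam j < lam i)
    (mu : Fin n → ℕ)
    (hmu : mu = Function.update (Function.update lam i (lam i - 1)) j (lam j + 1))
    (hmudec : ∀ a b : Fin n, a ≤ b → mu b ≤ mu a)
    (hmusupp : ∀ k : Fin n, N - m ≤ (k : ℕ) → mu k = 0) :
    Dfun n m N mu ≤ Dfun n m N lam := by
  obtain ⟨a, ha⟩ : ∃ a, lam i = a + 1 := ⟨lam i - 1, by omega⟩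
  set nu := Function.update lam i a with hnu
  have hnui : nu i = a := Function.update_self ..
  have hnuj : nu j = lam j := Function.update_of_ne hij.ne' _ _
  have hlam_eq : lam = Function.update nu i (nu i + 1) := by
    rw [hnui, hnu, Function.update_idem, ← ha, Function.update_eq_self]
  have hmu_eq : mu = Function.update nu j (nu j + 1) := by
    rw [hmu, hnuj, ha, Nat.add_sub_cancel]
  have hnu0 : 0 ≤ Dfun n m N nu := by
    refine Dfun_nonneg n m N hN nu fun k hk => ?_
    have hlk := hsupp k hk
    by_cases hki : k = i
    · subst hki
      omega
    · rw [hnu, Function.update_of_ne hki, hlk]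
  have hD := Dfun_update_succ n m N nu i
  rw [← hlam_eq, hnui] at hD
  have hD' := Dfun_update_succ n m N nu j
  rw [← hmu_eq, hnuj] at hD'
  rw [hD, hD']
  refine mul_le_mul_of_nonneg_left ?_ hnu0
  have hab : (lam j : ℚ) ≤ a := by exact_mod_cast (by omega : lam j ≤ a)
  have hijq : ((i : ℕ) : ℚ) < (j : ℕ) := by exact_mod_cast hij
  have hjn : ((j : ℕ) : ℚ) + n < N := by
    exact_mod_cast (by omega : (j : ℕ) + n < N)
  have hmn : (n : ℚ) ≤ m := by exact_mod_cast hnm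
  have hb0 : (0 : ℚ) ≤ lam j := Nat.cast_nonneg _
  rw [div_le_div_iff₀ (by linarith) (by linarith)]
  nlinarith [mul_nonneg (sub_nonneg.mpr hmn)
    (by linarith : (0 : ℚ) ≤ (a - (i : ℕ)) - (lam j - (j : ℕ)))]
end

section
/- Let m and N be integers with 1 ≤ m ≤ N − 1 and N ≥ 2. Then f^{(m, (m−1)^{N−m−1})} = [(N − m)(1 + (m − 1)(N − m)) / (N − 1)] · f^{((m−1)^{N−m})}, where (m, (m−1)^{N−m−1}) denotes the partition of length N − m whose first part is m followed by N − m − 1 parts equal to m − 1, and ((m−1)^{N−m}) denotes the partition consisting of N − m parts equal to m − 1. -/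
open Finset

/-- Adding a box to the first row of the rectangle with `n + 1` rows of length `a`. -/
theorem fSYT_rectangle_add_box (a n : ℕ) :
    fSYT (n + 1) (fun i => if (i : ℕ) = 0 then a + 1 else a)
      = (((n : ℚ) + 1) * (1 + (a : ℚ) * ((n : ℚ) + 1)) / ((a : ℚ) + n + 1)) *
          fSYT (n + 1) (fun _ => a) := by
  have hprod : ∀ k : ℕ, ∏ j : Fin k, ((j : ℚ) + 1) = (k.factorial : ℚ) := fun k => by
    rw [Fin.prod_univ_eq_prod_range (fun j : ℕ => (j : ℚ) + 1) k]
    exact_mod_cast Finset.prod_range_add_one_eq_factorial k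
  have hprod' : ∏ j : Fin n, ((j : ℚ) + 1 + 1) = ((n + 1).factorial : ℚ) := by
    rw [← hprod (n + 1), Fin.prod_univ_succ]
    simp
  have hsum : a + 1 + n * a = (n + 1) * a + 1 := by ring
  have hfac : a + 1 + n = (a + n) + 1 := by ring
  have hne : ((a : ℚ) + n + 1) ≠ 0 := by positivity
  have hden : ∏ i : Fin n, ((a + n - ((i : ℕ) + 1)).factorial : ℚ) ≠ 0 :=
    Finset.prod_ne_zero_iff.2 fun i _ => by positivity
  have hden' : ((a + n).factorial : ℚ) ≠ 0 := by positivity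
  unfold fSYT
  simp only [Fin.prod_univ_succ, Fin.sum_univ_succ, Fin.prod_Ioi_zero, Fin.prod_Ioi_succ,
    Fin.val_zero, Fin.val_succ, if_true, Nat.succ_ne_zero, if_false, Nat.cast_add, Nat.cast_one,
    Nat.cast_zero, sub_zero, add_sub_cancel_left, sub_self, zero_add, Finset.sum_const,
    Finset.card_univ, Fintype.card_fin, smul_eq_mul, hprod, ← add_assoc, Nat.add_sub_cancel,
    Nat.sub_zero]
  have hrow : ∏ j : Fin n, ((1 : ℚ) + j + 1) = ((n + 1).factorial : ℚ) := by
    rw [← hprod']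
    exact Finset.prod_congr rfl fun j _ => by ring
  rw [hrow, hsum, hfac]
  simp only [Nat.factorial_succ]
  push_cast
  field_simp
  ring

/-- For 1 <= m <= N - 1 and N >= 2,
f^{(m, (m-1)^{N-m-1})} = [(N-m)(1 + (m-1)(N-m))/(N-1)] * f^{((m-1)^{N-m})},
both shapes being partitions of length N - m. -/
theorem fSYT_curve_identity (m N : ℕ) (hm : 1 ≤ m) (hmN : m + 1 ≤ N)
    (hN : 2 ≤ N) :
    fSYT (N - m) (fun i => if (i : ℕ) = 0 then m else m - 1)
      = (((N : ℚ) - m) * (1 + ((m : ℚ) - 1) * ((N : ℚ) - m)) / ((N : ℚ) - 1)) *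
          fSYT (N - m) (fun _ => m - 1) := by
  obtain ⟨a, rfl⟩ := Nat.exists_eq_add_of_le' hm
  obtain ⟨n, rfl⟩ := Nat.exists_eq_add_of_le hmN
  have he : a + 1 + 1 + n - (a + 1) = n + 1 := by omega
  rw [he, Nat.add_sub_cancel, fSYT_rectangle_add_box]
  push_cast
  congr 2 <;> ring
end

section
/- Let n ≥ 1 and m, N be integers with n ≤ m ≤ N − 1 and N ≥ 2n. Set ε := ((m−n)^{N−m}) (N − m copies of m − n), A := ∑_λ f^λ · f^{λ+ε} · ∏_{i=1}^{N−m} (n+i)!/(n+i−λ_i)! and B := C(n + (m−n)(N−m), n) · f^{((N−m)^{m−n})} · ∑_λ (f^λ)² · ∏_{i=1}^{N−m} (n+i)!/(n+i−λ_i)!, where both sums run over all partitions λ = (λ_1, …, λ_{N−m}) of n with at most N − m parts, f^λ and f^{λ+ε} are computed with length N − m, and f^{((N−m)^{m−n})} is computed with length m − n. Then (C(N−m, n)/C(N−n, n)) · B ≤ A ≤ (C(N−m+n−1, n)/C(N−1, n)) · B, where C(a, n) := 0 if a < n. -/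
open Finset

/-- The increasing function `x ↦ x / (d + x)` on the natural numbers. -/
def shiftRatio (d x : ℕ) : ℚ := (x : ℚ) / ((d + x : ℕ) : ℚ)

lemma shiftRatio_nonneg (d x : ℕ) : 0 ≤ shiftRatio d x := by
  unfold shiftRatio
  positivity

lemma shiftRatio_mono (d : ℕ) : Monotone (shiftRatio d) := by
  intro x y hxy
  rcases Nat.eq_zero_or_pos x with rfl | hx
  · simpa [shiftRatio] using shiftRatio_nonneg d y
  · unfold shiftRatio
    rw [div_le_div_iff₀ (by positivity) (by exact_mod_cast (by omega : 0 < d + y))]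
    norm_cast
    nlinarith [Nat.mul_le_mul_right d hxy]

/-- The product over the cells of the shape `lam` of `(e + c) / (d + e + c)`, with `c` the content
of the cell. -/
def contentRatio (e d : ℕ) (lam : Fin e → ℕ) : ℚ :=
  ∏ i : Fin e, ∏ j ∈ range (lam i), shiftRatio d (e - i + j)

lemma contentRatio_nonneg (e d : ℕ) (lam : Fin e → ℕ) : 0 ≤ contentRatio e d lam :=
  prod_nonneg fun _ _ => prod_nonneg fun _ _ => shiftRatio_nonneg _ _

/-- Reading a product over an initial segment in consecutive blocks of lengths `a 0, a 1, …`. -/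
lemma prod_range_blocks {M : Type*} [CommMonoid M] (G : ℕ → M) (a : ℕ → ℕ) (e : ℕ) :
    ∏ i ∈ range e, ∏ j ∈ range (a i), G ((∑ l ∈ range i, a l) + j) =
      ∏ k ∈ range (∑ i ∈ range e, a i), G k := by
  induction e with
  | zero => simp
  | succ e ih => rw [prod_range_succ, ih, sum_range_succ, prod_range_add]

lemma prod_fin_blocks {M : Type*} [CommMonoid M] (G : ℕ → M) (e : ℕ) (lam : Fin e → ℕ) :
    ∏ i : Fin e, ∏ j ∈ range (lam i), G ((∑ l ∈ Iio i, lam l) + j) =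
      ∏ k ∈ range (∑ i, lam i), G k := by
  let a : ℕ → ℕ := fun i => if h : i < e then lam ⟨i, h⟩ else 0
  have ha : ∀ i : Fin e, a i = lam i := fun i => by simp [a]
  have hs : ∀ i : Fin e, ∑ l ∈ range i, a l = ∑ l ∈ Iio i, lam l := by
    intro i
    symm
    refine sum_bij (fun l _ => (l : ℕ)) ?_ ?_ ?_ ?_
    · intro l hl
      simpa using hl
    · intro l _ l' _ h
      exact Fin.ext h
    · intro b hb
      have hb' : b < i := by simpa using hb
      exact ⟨⟨b, hb'.trans i.2⟩, by simpa [Fin.lt_def] using hb', rfl⟩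
    · intro l _
      exact (ha l).symm
  have h := prod_range_blocks G a e
  rw [prod_range, sum_range] at h
  simpa only [ha, hs] using h

lemma contentRatio_le (e d : ℕ) (lam : Fin e → ℕ) :
    contentRatio e d lam ≤ ∏ k ∈ range (∑ i, lam i), shiftRatio d (e + k) := by
  rw [← prod_fin_blocks (fun k => shiftRatio d (e + k))]
  refine prod_le_prod (fun _ _ => prod_nonneg fun _ _ => shiftRatio_nonneg _ _) fun i _ =>
    prod_le_prod (fun _ _ => shiftRatio_nonneg _ _) fun j _ => shiftRatio_mono d ?_
  omega

lemma le_contentRatio (e d : ℕ) (lam : Fin e → ℕ) (hlam : ∀ i j : Fin e, i ≤ j → lam j ≤ lam i) :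
    ∏ k ∈ range (∑ i, lam i), shiftRatio d (e - k) ≤ contentRatio e d lam := by
  rw [← prod_fin_blocks (fun k => shiftRatio d (e - k))]
  refine prod_le_prod (fun _ _ => prod_nonneg fun _ _ => shiftRatio_nonneg _ _) fun i _ =>
    prod_le_prod (fun _ _ => shiftRatio_nonneg _ _) fun j hj => shiftRatio_mono d ?_
  have hpos : 0 < lam i := by
    have := mem_range.1 hj
    omega
  have hi : (i : ℕ) ≤ ∑ l ∈ Iio i, lam l := by
    have h := card_nsmul_le_sum (Iio i) lam 1 fun l hl =>
      hpos.trans_le (hlam l i (mem_Iio.1 hl).le)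
    simpa using h
  omega

lemma prod_shiftRatio_add (e d n : ℕ) :
    ∏ k ∈ range n, shiftRatio d (e + k) =
      ((e + n - 1).choose n : ℚ) / ((d + e + n - 1).choose n : ℚ) := by
  have h1 : ∏ k ∈ range n, ((e + k : ℕ) : ℚ) = n.factorial * ((e + n - 1).choose n : ℚ) := by
    rw [← Nat.cast_prod, ← Nat.ascFactorial_eq_prod_range,
      Nat.ascFactorial_eq_factorial_mul_choose']
    push_cast
    rfl
  have h2 : ∏ k ∈ range n, ((d + (e + k) : ℕ) : ℚ) =
      n.factorial * ((d + e + n - 1).choose n : ℚ) := by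
    simp only [← add_assoc]
    rw [← Nat.cast_prod, ← Nat.ascFactorial_eq_prod_range,
      Nat.ascFactorial_eq_factorial_mul_choose']
    push_cast
    rfl
  simp only [shiftRatio]
  rw [prod_div_distrib, h1, h2, mul_div_mul_left _ _ (by positivity)]

lemma prod_shiftRatio_sub (e d n : ℕ) (hne : n ≤ e) :
    ∏ k ∈ range n, shiftRatio d (e - k) = (e.choose n : ℚ) / ((d + e).choose n : ℚ) := by
  have h1 : ∏ k ∈ range n, ((e - k : ℕ) : ℚ) = n.factorial * (e.choose n : ℚ) := by
    rw [← Nat.cast_prod, ← Nat.descFactorial_eq_prod_range,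
      Nat.descFactorial_eq_factorial_mul_choose]
    push_cast
    rfl
  have h2 : ∏ k ∈ range n, ((d + (e - k) : ℕ) : ℚ) = n.factorial * ((d + e).choose n : ℚ) := by
    rw [← Nat.cast_mul, ← Nat.descFactorial_eq_factorial_mul_choose,
      Nat.descFactorial_eq_prod_range, Nat.cast_prod]
    refine prod_congr rfl fun k hk => ?_
    have := mem_range.1 hk
    congr 1
    omega
  simp only [shiftRatio]
  rw [prod_div_distrib, h1, h2, mul_div_mul_left _ _ (by positivity)]

lemma prod_Ioi_sub (e : ℕ) :
    ∏ i : Fin e, ∏ j ∈ Ioi i, (((j : ℕ) : ℚ) - ((i : ℕ) : ℚ)) =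
      ∏ i ∈ range e, (i.factorial : ℚ) := by
  induction e with
  | zero => simp
  | succ e ih =>
    rw [Fin.prod_univ_succ, prod_range_succ, ← ih, mul_comm]
    congr 1
    · refine prod_congr rfl fun i _ => ?_
      rw [Fin.prod_Ioi_succ]
      simp
    · rw [Fin.prod_Ioi_zero, ← prod_range_add_one_eq_factorial, Nat.cast_prod, prod_range]
      simp

lemma prod_factorial_shift (e d : ℕ) :
    (∏ i ∈ range e, (i.factorial : ℚ)) * ∏ i ∈ range d, ((e + i).factorial : ℚ) =
      (∏ i ∈ range d, (i.factorial : ℚ)) * ∏ i ∈ range e, ((d + i).factorial : ℚ) := by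
  rw [← prod_range_add (fun i => (i.factorial : ℚ)), ← prod_range_add (fun i => (i.factorial : ℚ)),
    add_comm]

lemma prod_fin_factorial_sub (e d : ℕ) :
    ∏ i : Fin e, ((d + e - 1 - (i : ℕ)).factorial : ℚ) =
      ∏ i ∈ range e, ((d + i).factorial : ℚ) := by
  rw [← prod_range (fun i => ((d + e - 1 - i).factorial : ℚ)), ← prod_range_reflect]
  refine prod_congr rfl fun i hi => ?_
  have := mem_range.1 hi
  congr 2
  omega

/-- The number of standard tableaux of a rectangle, computed from the transposed rectangle. -/
lemma fSYT_rectangle (e d : ℕ) :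
    fSYT d (fun _ => e) = ((d * e).factorial : ℚ) * (∏ i ∈ range e, (i.factorial : ℚ)) /
      ∏ i ∈ range e, ((d + i).factorial : ℚ) := by
  have hpos : ∀ a b : ℕ, ∏ i ∈ range a, ((b + i).factorial : ℚ) ≠ 0 := fun a b =>
    prod_ne_zero_iff.2 fun i _ => by positivity
  simp only [fSYT, sub_self, zero_add, sum_const, card_univ, Fintype.card_fin, smul_eq_mul]
  rw [prod_Ioi_sub, prod_fin_factorial_sub, div_eq_div_iff (hpos _ _) (hpos _ _), mul_assoc,
    mul_assoc, prod_factorial_shift]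

lemma prod_factorial_add (e d : ℕ) (lam : Fin e → ℕ) :
    ∏ i : Fin e, ((lam i + d + e - 1 - (i : ℕ)).factorial : ℚ) =
      (∏ i ∈ range e, ((d + i).factorial : ℚ)) *
        ∏ i : Fin e, ∏ j ∈ range (lam i), ((d + (e - i + j) : ℕ) : ℚ) := by
  rw [← prod_fin_factorial_sub, ← prod_mul_distrib]
  refine prod_congr rfl fun i _ => ?_
  have hi := i.2
  have h := Nat.factorial_mul_ascFactorial (d + e - 1 - i) (lam i)
  rw [Nat.ascFactorial_eq_prod_range] at h
  rw [← Nat.cast_prod, ← Nat.cast_mul]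
  congr 1
  rw [show lam i + d + e - 1 - (i : ℕ) = d + e - 1 - i + lam i by omega, ← h]
  congr 1
  refine prod_congr rfl fun j _ => ?_
  omega

lemma fSYT_add_const (e d : ℕ) (lam : Fin e → ℕ) :
    fSYT e (fun i => lam i + d) =
      ((((∑ i, lam i) + d * e).choose (∑ i, lam i) : ℚ) * fSYT d (fun _ => e)) *
        (fSYT e lam * contentRatio e d lam) := by
  have hsum : ∑ i, (lam i + d) = (∑ i, lam i) + d * e := by
    simp [sum_add_distrib, mul_comm]
  have h0 := prod_factorial_add e 0 lam
  simp only [add_zero, zero_add] at h0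
  have hchoose := Nat.add_choose_mul_factorial_mul_factorial (∑ i, lam i) (d * e)
  rw [← Nat.choose_symm_add] at hchoose
  have hchoose' : (((∑ i, lam i) + d * e).choose (∑ i, lam i) : ℚ) * (∑ i, lam i).factorial *
      (d * e).factorial = ((∑ i, lam i) + d * e).factorial := by exact_mod_cast hchoose
  have hG : ∏ i ∈ range e, (i.factorial : ℚ) ≠ 0 := prod_ne_zero_iff.2 fun i _ => by positivity
  have hGd : ∏ i ∈ range e, ((d + i).factorial : ℚ) ≠ 0 :=
    prod_ne_zero_iff.2 fun i _ => by positivity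
  have hP : ∀ c : ℕ, ∏ i : Fin e, ∏ j ∈ range (lam i), ((c + (e - i + j) : ℕ) : ℚ) ≠ 0 := by
    refine fun c => prod_ne_zero_iff.2 fun i _ => prod_ne_zero_iff.2 fun j _ => ?_
    have := i.2
    exact_mod_cast (by omega : c + (e - i + j) ≠ 0)
  have hP0 := hP 0
  simp only [zero_add] at hP0
  rw [fSYT_rectangle]
  simp only [contentRatio, shiftRatio, prod_div_distrib, fSYT, hsum]
  rw [prod_factorial_add, h0, ← hchoose']
  simp only [Nat.cast_add, add_sub_add_right_eq_sub]
  simp only [Nat.cast_add] at hP hP0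
  have hPd := hP d
  field_simp

/-- Combinatorial content of Corollary 0.2 (degree bounds): with
eps = ((m-n)^{N-m}),
A := sum over partitions lam of n with at most N-m parts of
f^lam * f^{lam+eps} * prod_{i=1}^{N-m} (n+i)!/(n+i-lam_i)!, and
B := C(n+(m-n)(N-m), n) * f^{((N-m)^{m-n})} *
sum over the same lam of (f^lam)^2 * prod_{i=1}^{N-m} (n+i)!/(n+i-lam_i)!,
one has (C(N-m,n)/C(N-n,n)) * B <= A <= (C(N-m+n-1,n)/C(N-1,n)) * B. -/
theorem degree_bounds_combinatorial (n m N : ℕ) (hn : 0 < n) (hnm : n ≤ m)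
    (hmN : m + 1 ≤ N) (hN : 2 * n ≤ N) :
    (((N - m).choose n : ℚ) / ((N - n).choose n : ℚ)) *
        (((n + (m - n) * (N - m)).choose n : ℚ) *
          fSYT (m - n) (fun _ => N - m) *
          ∑ lam ∈ partitionsOf (N - m) n,
            (fSYT (N - m) lam) ^ 2 *
              ∏ i : Fin (N - m),
                ((n + ((i : ℕ) + 1)).factorial : ℚ) /
                  ((n + ((i : ℕ) + 1) - lam i).factorial : ℚ))
      ≤ (∑ lam ∈ partitionsOf (N - m) n,
          fSYT (N - m) lam * fSYT (N - m) (fun i => lam i + (m - n)) *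
            ∏ i : Fin (N - m),
              ((n + ((i : ℕ) + 1)).factorial : ℚ) /
                ((n + ((i : ℕ) + 1) - lam i).factorial : ℚ))
    ∧ (∑ lam ∈ partitionsOf (N - m) n,
          fSYT (N - m) lam * fSYT (N - m) (fun i => lam i + (m - n)) *
            ∏ i : Fin (N - m),
              ((n + ((i : ℕ) + 1)).factorial : ℚ) /
                ((n + ((i : ℕ) + 1) - lam i).factorial : ℚ))
      ≤ (((N - m + n - 1).choose n : ℚ) / ((N - 1).choose n : ℚ)) *
        (((n + (m - n) * (N - m)).choose n : ℚ) *
          fSYT (m - n) (fun _ => N - m) *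
          ∑ lam ∈ partitionsOf (N - m) n,
            (fSYT (N - m) lam) ^ 2 *
              ∏ i : Fin (N - m),
                ((n + ((i : ℕ) + 1)).factorial : ℚ) /
                  ((n + ((i : ℕ) + 1) - lam i).factorial : ℚ)) := by
  obtain ⟨e, rfl⟩ : ∃ e, N = m + e := ⟨N - m, by omega⟩
  obtain ⟨d, rfl⟩ : ∃ d, m = n + d := ⟨m - n, by omega⟩
  rw [show n + d + e - (n + d) = e by omega, show n + d - n = d by omega,
    show n + d + e - n = d + e by omega, show n + d + e - 1 = d + e + n - 1 by omega]
  set K : ℚ := ((n + d * e).choose n : ℚ) * fSYT d (fun _ => e) with hK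
  have hK0 : 0 ≤ K := by
    rw [hK, fSYT_rectangle]
    positivity
  set w : (Fin e → ℕ) → ℚ := fun lam => ∏ i : Fin e,
    ((n + ((i : ℕ) + 1)).factorial : ℚ) / ((n + ((i : ℕ) + 1) - lam i).factorial : ℚ) with hw
  have hw0 : ∀ lam, 0 ≤ w lam := fun lam => prod_nonneg fun i _ => by positivity
  have hA : ∑ lam ∈ partitionsOf e n, fSYT e lam * fSYT e (fun i => lam i + d) * w lam =
      ∑ lam ∈ partitionsOf e n, contentRatio e d lam * (K * (fSYT e lam ^ 2 * w lam)) := by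
    refine sum_congr rfl fun lam hlam => ?_
    have hs : ∑ i, lam i = n := (mem_filter.1 hlam).2.2
    rw [fSYT_add_const, hs, ← hK]
    ring
  have hterm : ∀ lam, 0 ≤ K * (fSYT e lam ^ 2 * w lam) := fun lam =>
    mul_nonneg hK0 (mul_nonneg (sq_nonneg _) (hw0 lam))
  change _ * (K * ∑ lam ∈ partitionsOf e n, fSYT e lam ^ 2 * w lam) ≤
      ∑ lam ∈ partitionsOf e n, fSYT e lam * fSYT e (fun i => lam i + d) * w lam ∧
    ∑ lam ∈ partitionsOf e n, fSYT e lam * fSYT e (fun i => lam i + d) * w lam ≤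
      _ * (K * ∑ lam ∈ partitionsOf e n, fSYT e lam ^ 2 * w lam)
  rw [hA, mul_sum, mul_sum, mul_sum]
  constructor
  · refine sum_le_sum fun lam hlam => mul_le_mul_of_nonneg_right ?_ (hterm lam)
    obtain ⟨hanti, hs⟩ := (mem_filter.1 hlam).2
    rcases le_or_gt n e with hne | hne
    · rw [← prod_shiftRatio_sub e d n hne, ← hs]
      exact le_contentRatio e d lam hanti
    · rw [Nat.choose_eq_zero_of_lt hne]
      simpa using contentRatio_nonneg e d lam
  · refine sum_le_sum fun lam hlam => mul_le_mul_of_nonneg_right ?_ (hterm lam)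
    have hs : ∑ i, lam i = n := (mem_filter.1 hlam).2.2
    rw [← prod_shiftRatio_add e d n, ← hs]
    exact contentRatio_le e d lam
end

section
/- Let m ≥ 2 and e ≥ 1 be integers, and set N := m + e and M := 2 + (m−2)e. Then f^{(m, (m−2)^{e−1})} = [(e+1)e / ((N−1)(N−2))] · C(M, 2) · f^{((m−2)^e)}, where (m, (m−2)^{e−1}) denotes the partition of length e with first part m followed by e − 1 parts equal to m − 2, and ((m−2)^e) denotes e copies of m − 2. -/
open Finset

theorem prod_fin_add_three (n : ℕ) :
    ∏ j : Fin n, (((j : ℕ) : ℚ) + 3) = ((n : ℚ) + 2) * (n + 1) / 2 * n.factorial := by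
  induction n with
  | zero => norm_num
  | succ n ih =>
    rw [Fin.prod_univ_castSucc]
    simp only [Fin.val_castSucc, Fin.val_last, ih, Nat.factorial_succ]
    push_cast
    ring

theorem prod_fin_add_one (n : ℕ) :
    ∏ j : Fin n, (((j : ℕ) : ℚ) + 1) = n.factorial := by
  induction n with
  | zero => norm_num
  | succ n ih =>
    rw [Fin.prod_univ_castSucc]
    simp only [Fin.val_castSucc, Fin.val_last, ih, Nat.factorial_succ]
    push_cast
    ring

/-- For m >= 2, e >= 1, N := m + e, M := 2 + (m-2)e:
f^{(m, (m-2)^{e-1})} = [(e+1)e / ((N-1)(N-2))] * C(M,2) * f^{((m-2)^e)},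
all shapes of length e. -/
theorem fSYT_surface_first (m e N M : ℕ) (hm : 2 ≤ m) (he : 1 ≤ e)
    (hN : N = m + e) (hM : M = 2 + (m - 2) * e) :
    fSYT e (fun i => if (i : ℕ) = 0 then m else m - 2)
      = (((e : ℚ) + 1) * (e : ℚ) / (((N : ℚ) - 1) * ((N : ℚ) - 2))) *
          (M.choose 2 : ℚ) * fSYT e (fun _ => m - 2) := by
  obtain ⟨k, rfl⟩ := Nat.exists_eq_add_of_le' hm
  obtain ⟨n, rfl⟩ := Nat.exists_eq_add_of_le' he
  subst hN hM
  have hrow : ∏ j : Fin n, (((k + 2 : ℕ) : ℚ) - (k : ℚ) + ((j : ℕ) + 1 : ℕ) - ((0 : ℕ) : ℚ))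
      = ((n : ℚ) + 2) * (n + 1) / 2 * n.factorial := by
    rw [← prod_fin_add_three]
    refine Finset.prod_congr rfl fun j _ => ?_
    push_cast
    ring
  have hrow' : ∏ j : Fin n, ((k : ℚ) - (k : ℚ) + ((j : ℕ) + 1 : ℕ) - ((0 : ℕ) : ℚ))
      = n.factorial := by
    rw [← prod_fin_add_one]
    refine Finset.prod_congr rfl fun j _ => ?_
    push_cast
    ring
  have hsum : k + 2 + n * k = k * (n + 1) + 2 := by ring
  have hsum' : (n + 1) * k = k * (n + 1) := Nat.mul_comm _ _
  simp only [fSYT, Fin.sum_univ_succ, Fin.prod_univ_succ, Fin.prod_Ioi_zero, Fin.prod_Ioi_succ,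
    Fin.val_zero, Fin.val_succ, if_true, Nat.add_eq_zero_iff, one_ne_zero, and_false, if_false,
    Nat.add_sub_cancel, hrow, hrow', Finset.sum_const, Finset.card_univ, Fintype.card_fin,
    smul_eq_mul, hsum, hsum']
  rw [show k + 2 + (n + 1) - 1 - 0 = (k + n) + 2 by omega,
    show k + (n + 1) - 1 - 0 = k + n by omega, Nat.add_comm 2 (k * (n + 1)), Nat.cast_choose_two]
  have hD : ∏ i : Fin n, ((k + (n + 1) - 1 - ((i : ℕ) + 1)).factorial : ℚ) ≠ 0 :=
    Finset.prod_ne_zero_iff.2 fun i _ => by positivity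
  have hF : ((k + n).factorial : ℚ) ≠ 0 := by positivity
  have h1 : (k : ℚ) + n + 1 ≠ 0 := by positivity
  have h2 : (k : ℚ) + n + 2 ≠ 0 := by positivity
  have e1 : ((k + 2 + (n + 1) : ℕ) : ℚ) - 1 = k + n + 2 := by push_cast; ring
  have e2 : ((k + 2 + (n + 1) : ℕ) : ℚ) - 2 = k + n + 1 := by push_cast; ring
  rw [e1, e2]
  generalize ∏ i : Fin n, ((k + (n + 1) - 1 - ((i : ℕ) + 1)).factorial : ℚ) = D at *
  simp only [Nat.factorial_succ]
  push_cast
  field_simp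
  ring
end

section
/- Let m ≥ 2 and e ≥ 2 be integers, and set N := m + e and M := 2 + (m−2)e. Then f^{((m−1)^2, (m−2)^{e−2})} = [e(e−1) / ((N−2)(N−3))] · C(M, 2) · f^{((m−2)^e)}, where ((m−1)^2, (m−2)^{e−2}) denotes the partition of length e with two parts equal to m − 1 followed by e − 2 parts equal to m − 2, and ((m−2)^e) denotes e copies of m − 2. -/
open Finset

/-- The product of `k` consecutive rationals starting at `c + 1`, compared with the one
starting at `c`. -/
theorem prod_fin_add_one_mul (k : ℕ) (c : ℚ) :
    (∏ j : Fin k, (((j : ℕ) : ℚ) + c + 1)) * c = (k + c) * ∏ j : Fin k, (((j : ℕ) : ℚ) + c) := by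
  induction k with
  | zero => simp
  | succ k ih =>
    rw [Fin.prod_univ_castSucc, Fin.prod_univ_castSucc]
    simp only [Fin.val_castSucc, Fin.val_last]
    push_cast
    linear_combination ((k : ℚ) + c + 1) * ih

/-- Formula for `fSYT` of a shape of length `k + 2` with two parts `b` followed by `k` parts `a`,
with the factors of the first two rows written separately. -/
theorem fSYT_two_rows (k a b : ℕ) :
    fSYT (k + 2) (fun i => if (i : ℕ) < 2 then b else a) =
      ((2 * b + k * a).factorial : ℚ) *
        ((∏ j : Fin k, (((j : ℕ) : ℚ) + ((b : ℚ) - a + 2))) *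
          (∏ j : Fin k, (((j : ℕ) : ℚ) + ((b : ℚ) - a + 1))) *
          ∏ i : Fin k, ∏ j ∈ Finset.Ioi i, (((j : ℕ) : ℚ) - ((i : ℕ) : ℚ))) /
      (((b + k + 1).factorial : ℚ) * ((b + k).factorial : ℚ) *
        ∏ i : Fin k, ((a + k - 1 - (i : ℕ)).factorial : ℚ)) := by
  have hs : ∑ i : Fin (k + 2), (if (i : ℕ) < 2 then b else a) = 2 * b + k * a := by
    simp [Fin.sum_univ_succ]
    ring
  unfold fSYT
  rw [hs]
  congr 1
  · congr 1
    simp only [Fin.prod_univ_succ, Fin.prod_Ioi_zero, Fin.prod_Ioi_succ]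
    simp only [Fin.val_zero, Fin.val_succ]
    rw [← mul_assoc]
    congr 1
    · simp
      congr 1 <;> refine Finset.prod_congr rfl fun j _ => ?_ <;> ring
    · refine Finset.prod_congr rfl fun i _ => Finset.prod_congr rfl fun j _ => ?_
      simp
  · simp only [Fin.prod_univ_succ]
    rw [← mul_assoc]
    congr 1
    refine Finset.prod_congr rfl fun i _ => ?_
    simp only [Fin.val_succ]
    rw [if_neg (by omega)]
    congr 2
    omega

/-- For m >= 2, e >= 2, N := m + e, M := 2 + (m-2)e:
f^{((m-1)^2, (m-2)^{e-2})} = [e(e-1) / ((N-2)(N-3))] * C(M,2) * f^{((m-2)^e)},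
all shapes of length e. -/
theorem fSYT_surface_second (m e N M : ℕ) (hm : 2 ≤ m) (he : 2 ≤ e)
    (hN : N = m + e) (hM : M = 2 + (m - 2) * e) :
    fSYT e (fun i => if (i : ℕ) < 2 then m - 1 else m - 2)
      = ((e : ℚ) * ((e : ℚ) - 1) / (((N : ℚ) - 2) * ((N : ℚ) - 3))) *
          (M.choose 2 : ℚ) * fSYT e (fun _ => m - 2) := by
  obtain ⟨a, rfl⟩ := Nat.exists_eq_add_of_le' hm
  obtain ⟨k, rfl⟩ := Nat.exists_eq_add_of_le' he
  subst hN
  simp only [Nat.add_sub_cancel, show a + 2 - 1 = a + 1 from rfl] at hM ⊢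
  have hconst := fSYT_two_rows k a a
  simp only [ite_self] at hconst
  rw [fSYT_two_rows, hconst, Nat.cast_choose_two]
  have h1 : 2 * (a + 1) + k * a = (2 * a + k * a) + 1 + 1 := by ring
  have hM' : M = (2 * a + k * a) + 2 := by rw [hM]; ring
  have hd : ∏ i : Fin k, ((a + k - 1 - (i : ℕ)).factorial : ℚ) ≠ 0 :=
    Finset.prod_ne_zero_iff.mpr fun i _ => by positivity
  have hP1 := prod_fin_add_one_mul k 1
  have hP2 := prod_fin_add_one_mul k 2
  rw [h1, hM', show a + 1 + k + 1 = a + k + 1 + 1 by ring, show a + 1 + k = a + k + 1 by ring]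
  simp only [Nat.factorial_succ]
  have e1 : ∀ x : ℚ, x + (((a + 1 : ℕ) : ℚ) - a + 2) = x + 2 + 1 := fun x => by push_cast; ring
  have e2 : ∀ x : ℚ, x + (((a + 1 : ℕ) : ℚ) - a + 1) = x + 2 := fun x => by push_cast; ring
  have e3 : ∀ x : ℚ, x + ((a : ℚ) - a + 2) = x + 2 := fun x => by ring
  have e4 : ∀ x : ℚ, x + ((a : ℚ) - a + 1) = x + 1 := fun x => by ring
  have e5 : ∀ x : ℚ, x + 1 + 1 = x + 2 := fun x => by ring
  simp only [e1, e2, e3, e4]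
  simp only [e5] at hP1
  set P1 := ∏ j : Fin k, (((j : ℕ) : ℚ) + 1)
  set P2 := ∏ j : Fin k, (((j : ℕ) : ℚ) + 2)
  set P3 := ∏ j : Fin k, (((j : ℕ) : ℚ) + 2 + 1)
  set D := ∏ i : Fin k, ((a + k - 1 - (i : ℕ)).factorial : ℚ)
  set V := ∏ i : Fin k, ∏ j ∈ Finset.Ioi i, (((j : ℕ) : ℚ) - ((i : ℕ) : ℚ))
  have hf : ((a + k).factorial : ℚ) ≠ 0 := by positivity
  have hn2 : ((a + 2 + (k + 2) : ℕ) : ℚ) - 2 = a + k + 2 := by push_cast; ring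
  have hn3 : ((a + 2 + (k + 2) : ℕ) : ℚ) - 3 = a + k + 1 := by push_cast; ring
  have hx2 : (a : ℚ) + k + 2 ≠ 0 := by positivity
  have hx1 : (a : ℚ) + k + 1 ≠ 0 := by positivity
  have hP : P3 * P2 = (k + 2) * (k + 1) / 2 * (P2 * P1) := by
    linear_combination P2 / 2 * hP2 + (k + 2) * P2 / 2 * hP1
  rw [hn2, hn3, hP]
  push_cast
  simp only [e5]
  field_simp
  ring
end

section
/- Let m ≥ 2 and e ≥ 2 be integers, and set N := m + e and M := 2 + (m−2)e. Then f^{(m, (m−2)^{e−1})} + 2 · f^{((m−1)^2, (m−2)^{e−2})} = [e(3eN − N − 5e − 1) / ((N−1)(N−2)(N−3))] · C(M, 2) · f^{((m−2)^e)}, where all three shapes are partitions of length e: first part m followed by e − 1 parts m − 2; two parts m − 1 followed by e − 2 parts m − 2; and e copies of m − 2, respectively. -/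
open Finset

/-- A product of `n` consecutive integers as a quotient of factorials. -/
theorem prod_fin_add_mul_factorial (n c : ℕ) :
    (∏ j : Fin n, (((j : ℕ) : ℚ) + (c + 1))) * (c.factorial : ℚ) = ((n + c).factorial : ℚ) := by
  induction n with
  | zero => simp
  | succ n ih =>
    rw [Fin.prod_univ_castSucc, show n + 1 + c = n + c + 1 by ring, Nat.factorial_succ]
    push_cast
    rw [← ih]
    simp only [Fin.val_castSucc]
    ring

/-- `fSYT` of a shape whose rows from the third on have constant length `k`, with the
factors involving the first two rows split off. -/
theorem fSYT_of_tail_const (n a b k : ℕ) (lam : Fin (n + 2) → ℕ)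
    (h0 : lam 0 = a) (h1 : lam 1 = b) (h2 : ∀ i : Fin n, lam i.succ.succ = k) :
    fSYT (n + 2) lam = ((a + b + n * k).factorial : ℚ) *
      (((a : ℚ) - b + 1) * (∏ j : Fin n, (((j : ℕ) : ℚ) + ((a : ℚ) - k + 2))) *
        (∏ j : Fin n, (((j : ℕ) : ℚ) + ((b : ℚ) - k + 1))) *
        ∏ i : Fin n, ∏ j ∈ Finset.Ioi i, (((j : ℕ) : ℚ) - ((i : ℕ) : ℚ))) /
      (((a + n + 1).factorial : ℚ) * ((b + n).factorial : ℚ) *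
        ∏ i : Fin n, ((k + n - 1 - (i : ℕ)).factorial : ℚ)) := by
  have h1' : lam (Fin.succ 0) = b := h1
  have hsum : ∑ i, lam i = a + b + n * k := by
    simp [Fin.sum_univ_succ, h0, h1, h2, add_assoc]
  have hden : ∏ i : Fin (n + 2), ((lam i + (n + 2) - 1 - (i : ℕ)).factorial : ℚ) =
      ((a + n + 1).factorial : ℚ) * ((b + n).factorial : ℚ) *
        ∏ i : Fin n, ((k + n - 1 - (i : ℕ)).factorial : ℚ) := by
    rw [Fin.prod_univ_succ, Fin.prod_univ_succ, h0, h1', ← mul_assoc]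
    congr 1
    refine Finset.prod_congr rfl fun i _ => ?_
    rw [h2, Fin.val_succ, Fin.val_succ]
    congr 2
    omega
  have hnum : (∏ i : Fin (n + 2), ∏ j ∈ Finset.Ioi i,
      ((lam i : ℚ) - (lam j : ℚ) + ((j : ℕ) : ℚ) - ((i : ℕ) : ℚ))) =
      ((a : ℚ) - b + 1) * (∏ j : Fin n, (((j : ℕ) : ℚ) + ((a : ℚ) - k + 2))) *
        (∏ j : Fin n, (((j : ℕ) : ℚ) + ((b : ℚ) - k + 1))) *
        ∏ i : Fin n, ∏ j ∈ Finset.Ioi i, (((j : ℕ) : ℚ) - ((i : ℕ) : ℚ)) := by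
    rw [Fin.prod_univ_succ, Fin.prod_univ_succ, Fin.prod_Ioi_zero, Fin.prod_Ioi_succ,
      Fin.prod_Ioi_zero, Fin.prod_univ_succ, ← mul_assoc]
    simp only [Fin.prod_Ioi_succ, h0, h1', h2, Fin.val_succ, Fin.val_zero]
    congr 1
    · congr 1
      · congr 1
        · push_cast; ring
        · refine Finset.prod_congr rfl fun i _ => ?_
          push_cast; ring
      · refine Finset.prod_congr rfl fun i _ => ?_
        push_cast; ring
    · refine Finset.prod_congr rfl fun i _ => Finset.prod_congr rfl fun j _ => ?_
      push_cast; ring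
  rw [fSYT, hsum, hden, hnum]

/-- For m >= 2, e >= 2, N := m + e, M := 2 + (m-2)e:
f^{(m, (m-2)^{e-1})} + 2 f^{((m-1)^2, (m-2)^{e-2})}
= [e(3eN - N - 5e - 1) / ((N-1)(N-2)(N-3))] * C(M,2) * f^{((m-2)^e)},
all shapes of length e. -/
theorem fSYT_surface_sum (m e N M : ℕ) (hm : 2 ≤ m) (he : 2 ≤ e)
    (hN : N = m + e) (hM : M = 2 + (m - 2) * e) :
    fSYT e (fun i => if (i : ℕ) = 0 then m else m - 2)
        + 2 * fSYT e (fun i => if (i : ℕ) < 2 then m - 1 else m - 2)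
      = ((e : ℚ) * (3 * (e : ℚ) * (N : ℚ) - (N : ℚ) - 5 * (e : ℚ) - 1) /
            (((N : ℚ) - 1) * ((N : ℚ) - 2) * ((N : ℚ) - 3))) *
          (M.choose 2 : ℚ) * fSYT e (fun _ => m - 2) := by
  obtain ⟨k, rfl⟩ := Nat.exists_eq_add_of_le' hm
  obtain ⟨n, rfl⟩ := Nat.exists_eq_add_of_le' he
  subst hN hM
  simp only [Nat.add_sub_cancel, show k + 2 - 1 = k + 1 from rfl]
  rw [fSYT_of_tail_const n (k + 2) k k _ (by simp) (by simp) (by simp),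
    fSYT_of_tail_const n (k + 1) (k + 1) k _ (by simp) (by simp) (by simp),
    fSYT_of_tail_const n k k k _ rfl rfl (fun _ => rfl)]
  have p0 := prod_fin_add_mul_factorial n 0
  have p1 := prod_fin_add_mul_factorial n 1
  have p2 := prod_fin_add_mul_factorial n 2
  have p3 := prod_fin_add_mul_factorial n 3
  set V := ∏ i : Fin n, ∏ j ∈ Finset.Ioi i, (((j : ℕ) : ℚ) - ((i : ℕ) : ℚ))
  have hW : (∏ i : Fin n, ((k + n - 1 - (i : ℕ)).factorial : ℚ)) ≠ 0 :=
    Finset.prod_ne_zero_iff.2 fun i _ => by positivity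
  set W := ∏ i : Fin n, ((k + n - 1 - (i : ℕ)).factorial : ℚ)
  have e1 : ((k + 2 : ℕ) : ℚ) - k + 2 = ((3 : ℕ) : ℚ) + 1 := by push_cast; ring
  have e2 : ((k + 1 : ℕ) : ℚ) - k + 2 = ((2 : ℕ) : ℚ) + 1 := by push_cast; ring
  have e3 : ((k + 1 : ℕ) : ℚ) - k + 1 = ((1 : ℕ) : ℚ) + 1 := by push_cast; ring
  have e4 : (k : ℚ) - k + 2 = ((1 : ℕ) : ℚ) + 1 := by push_cast; ring
  have e5 : (k : ℚ) - k + 1 = ((0 : ℕ) : ℚ) + 1 := by push_cast; ring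
  rw [e1, e2, e3, e4, e5]
  have s1 : k + 2 + k + n * k = k + k + n * k + 1 + 1 := by ring
  have s2 : k + 1 + (k + 1) + n * k = k + k + n * k + 1 + 1 := by ring
  have s3 : 2 + k * (n + 2) = k + k + n * k + 1 + 1 := by ring
  have t1 : k + 2 + n + 1 = k + n + 1 + 1 + 1 := by ring
  have t2 : k + 1 + n + 1 = k + n + 1 + 1 := by ring
  have t3 : k + 1 + n = k + n + 1 := by ring
  rw [s1, s2, s3, t1, t2, t3, Nat.cast_choose_two]
  rw [show n + 3 = n + 1 + 1 + 1 from rfl] at p3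
  rw [show n + 2 = n + 1 + 1 from rfl] at p2
  rw [Nat.add_zero] at p0
  simp only [Nat.factorial_succ, Nat.factorial_zero] at p0 p1 p2 p3 ⊢
  generalize (∏ j : Fin n, (((j : ℕ) : ℚ) + (((0 : ℕ) : ℚ) + 1))) = P0 at *
  generalize (∏ j : Fin n, (((j : ℕ) : ℚ) + (((1 : ℕ) : ℚ) + 1))) = P1 at *
  generalize (∏ j : Fin n, (((j : ℕ) : ℚ) + (((2 : ℕ) : ℚ) + 1))) = P2 at *
  generalize (∏ j : Fin n, (((j : ℕ) : ℚ) + (((3 : ℕ) : ℚ) + 1))) = P3 at *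
  have hF : ((k + n).factorial : ℚ) ≠ 0 := by positivity
  push_cast at *
  obtain rfl : P0 = (n.factorial : ℚ) := by linarith
  obtain rfl : P1 = (n + 1) * (n.factorial : ℚ) := by linarith
  obtain rfl : P2 = (n + 1 + 1) * ((n + 1) * (n.factorial : ℚ)) / 2 := by linarith
  obtain rfl : P3 = (n + 1 + 1 + 1) * ((n + 1 + 1) * ((n + 1) * (n.factorial : ℚ))) / 6 := by
    linarith
  have d1 : (k : ℚ) + 2 + (n + 2) - 1 = k + n + 1 + 1 + 1 := by ring
  have d2 : (k : ℚ) + 2 + (n + 2) - 2 = k + n + 1 + 1 := by ring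
  have d3 : (k : ℚ) + 2 + (n + 2) - 3 = k + n + 1 := by ring
  rw [d1, d2, d3]
  have g1 : (k : ℚ) + n + 1 ≠ 0 := by positivity
  have g2 : (k : ℚ) + n + 1 + 1 ≠ 0 := by positivity
  have g3 : (k : ℚ) + n + 1 + 1 + 1 ≠ 0 := by positivity
  field_simp
  ring
end

section
/- Let m ≥ 3 and e ≥ 1 be integers, and set N := m + e and M := 3 + (m−3)e. Then f^{(m, (m−3)^{e−1})} = [(e+2)(e+1)e / ((N−1)(N−2)(N−3))] · C(M, 3) · f^{((m−3)^e)}, where (m, (m−3)^{e−1}) denotes the partition of length e with first part m followed by e − 1 parts equal to m − 3, and ((m−3)^e) denotes e copies of m − 3. -/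
open Finset

/-- The product of the consecutive integers `4, …, k + 3` is `(k + 3)! / 6`. -/
theorem six_mul_prod_add_four (k : ℕ) :
    6 * ∏ j : Fin k, (((j : ℕ) : ℚ) + 4)
      = (k + 3) * (k + 2) * (k + 1) * ∏ j : Fin k, (((j : ℕ) : ℚ) + 1) := by
  induction k with
  | zero => norm_num
  | succ k ih =>
    rw [Fin.prod_univ_castSucc, Fin.prod_univ_castSucc]
    simp only [Fin.val_castSucc, Fin.val_last]
    push_cast
    linear_combination ((k : ℚ) + 4) * ih

theorem factorial_add_three (n : ℕ) :
    ((n + 3).factorial : ℚ) = (n + 3) * (n + 2) * (n + 1) * n.factorial := by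
  simp only [Nat.factorial_succ]
  push_cast
  ring

theorem factorial_add_three_eq_choose (n : ℕ) :
    ((n + 3).factorial : ℚ) = 6 * (n + 3).choose 3 * n.factorial := by
  have h := Nat.add_choose_mul_factorial_mul_factorial n 3
  rw [← h, ← Nat.choose_symm_add]
  simp only [Nat.factorial]
  push_cast
  ring

/-- For m >= 3, e >= 1, N := m + e, M := 3 + (m-3)e:
f^{(m, (m-3)^{e-1})} = [(e+2)(e+1)e / ((N-1)(N-2)(N-3))] * C(M,3) * f^{((m-3)^e)},
all shapes of length e. -/
theorem fSYT_threefold_first (m e N M : ℕ) (hm : 3 ≤ m) (he : 1 ≤ e)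
    (hN : N = m + e) (hM : M = 3 + (m - 3) * e) :
    fSYT e (fun i => if (i : ℕ) = 0 then m else m - 3)
      = (((e : ℚ) + 2) * ((e : ℚ) + 1) * (e : ℚ) /
            (((N : ℚ) - 1) * ((N : ℚ) - 2) * ((N : ℚ) - 3))) *
          (M.choose 3 : ℚ) * fSYT e (fun _ => m - 3) := by
  obtain ⟨n, rfl⟩ := Nat.exists_eq_add_of_le' hm
  obtain ⟨k, rfl⟩ := Nat.exists_eq_add_of_le' he
  subst hN hM
  have hsum : n + 3 + k * n = n * (k + 1) + 3 := by ring
  have hfac : n + 3 + (k + 1) - 1 = n + k + 3 := by omega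
  have hfac' : n + (k + 1) - 1 = n + k := by omega
  simp only [fSYT, Fin.sum_univ_succ, Fin.prod_univ_succ, Fin.prod_Ioi_zero, Fin.prod_Ioi_succ,
    Fin.val_zero, Fin.val_succ, Nat.add_sub_cancel, if_true, Nat.add_eq_zero_iff, one_ne_zero,
    and_false, if_false, Finset.sum_const, Finset.card_univ, Fintype.card_fin, smul_eq_mul,
    hsum, hfac, hfac', Nat.sub_zero, add_comm 3 (n * (k + 1)), mul_comm (k + 1) n]
  rw [factorial_add_three_eq_choose, factorial_add_three (n + k)]
  have hfirst : ∏ j : Fin k, (((n + 3 : ℕ) : ℚ) - n + ((j : ℕ) + 1 : ℕ) - (0 : ℕ))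
      = ∏ j : Fin k, (((j : ℕ) : ℚ) + 4) :=
    Finset.prod_congr rfl fun j _ => by push_cast; ring
  have hfirst' : ∏ j : Fin k, ((n : ℚ) - n + ((j : ℕ) + 1 : ℕ) - (0 : ℕ))
      = ∏ j : Fin k, (((j : ℕ) : ℚ) + 1) :=
    Finset.prod_congr rfl fun j _ => by push_cast; ring
  rw [hfirst, hfirst']
  have hprod := six_mul_prod_add_four k
  have h1 : ((n + 3 + (k + 1) : ℕ) : ℚ) - 1 = (n + k : ℕ) + 3 := by push_cast; ring
  have h2 : ((n + 3 + (k + 1) : ℕ) : ℚ) - 2 = (n + k : ℕ) + 2 := by push_cast; ring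
  have h3 : ((n + 3 + (k + 1) : ℕ) : ℚ) - 3 = (n + k : ℕ) + 1 := by push_cast; ring
  rw [h1, h2, h3]
  generalize ∏ j : Fin k, (((j : ℕ) : ℚ) + 4) = A at *
  generalize ∏ j : Fin k, (((j : ℕ) : ℚ) + 1) = B at *
  obtain rfl : A = (k + 3) * (k + 2) * (k + 1) * B / 6 := by linarith
  push_cast
  field_simp
  ring
end

section
/- Let m ≥ 3 and e ≥ 3 be integers, and set N := m + e and M := 3 + (m−3)e. Then f^{((m−2)^3, (m−3)^{e−3})} = [e(e−1)(e−2) / ((N−3)(N−4)(N−5))] · C(M, 3) · f^{((m−3)^e)}, where ((m−2)^3, (m−3)^{e−3}) denotes the partition of length e with three parts equal to m − 2 followed by e − 3 parts equal to m − 3, and ((m−3)^e) denotes e copies of m − 3. -/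
open Finset

/-- A telescoping product: shifting every factor of `∏ (j + c)` by one. -/
theorem prod_fin_add_shift (k : ℕ) (c : ℚ) :
    c * ∏ j : Fin k, (((j : ℕ) : ℚ) + (c + 1)) = (k + c) * ∏ j : Fin k, (((j : ℕ) : ℚ) + c) := by
  induction k with
  | zero => simp
  | succ k ih =>
    simp only [Fin.prod_univ_castSucc, Fin.val_castSucc, Fin.val_last, Nat.cast_succ]
    linear_combination ((k : ℚ) + (c + 1)) * ih

/-- The double product in `fSYT`, with the first three rows split off. -/
theorem prod_Ioi_fin_add_three (k : ℕ) (f : Fin (k + 3) → Fin (k + 3) → ℚ) :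
    ∏ i, ∏ j ∈ Ioi i, f i j =
      f 0 1 * f 0 2 * f 1 2 *
        ((∏ j : Fin k, f 0 j.succ.succ.succ) * (∏ j : Fin k, f 1 j.succ.succ.succ) *
          ∏ j : Fin k, f 2 j.succ.succ.succ) *
        ∏ i : Fin k, ∏ j ∈ Ioi i, f i.succ.succ.succ j.succ.succ.succ := by
  simp only [Fin.prod_univ_succ, Fin.prod_Ioi_zero, Fin.prod_Ioi_succ]
  simp only [Fin.succ_zero_eq_one, Fin.succ_one_eq_two]
  ring

theorem factorial_add_three_eq (n : ℕ) :
    ((3 + n).factorial : ℚ) = 6 * ((3 + n).choose 3 : ℚ) * n.factorial := by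
  rw [← Nat.choose_mul_factorial_mul_factorial (Nat.le_add_right 3 n), Nat.add_sub_cancel_left]
  push_cast [Nat.factorial]
  ring

/-- For m >= 3, e >= 3, N := m + e, M := 3 + (m-3)e:
f^{((m-2)^3, (m-3)^{e-3})} = [e(e-1)(e-2) / ((N-3)(N-4)(N-5))] * C(M,3) * f^{((m-3)^e)},
all shapes of length e. -/
theorem fSYT_threefold_third (m e N M : ℕ) (hm : 3 ≤ m) (he : 3 ≤ e)
    (hN : N = m + e) (hM : M = 3 + (m - 3) * e) :
    fSYT e (fun i => if (i : ℕ) < 3 then m - 2 else m - 3)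
      = ((e : ℚ) * ((e : ℚ) - 1) * ((e : ℚ) - 2) /
            (((N : ℚ) - 3) * ((N : ℚ) - 4) * ((N : ℚ) - 5))) *
          (M.choose 3 : ℚ) * fSYT e (fun _ => m - 3) := by
  obtain ⟨a, rfl⟩ := Nat.exists_eq_add_of_le' hm
  obtain ⟨k, rfl⟩ := Nat.exists_eq_add_of_le' he
  subst hN hM
  have hrow : a + 3 - 2 = a + 1 := by omega
  have hsum : ∑ i : Fin (k + 3), (if (i : ℕ) < 3 then a + 1 else a) = 3 + a * (k + 3) := by
    simp only [Fin.sum_univ_succ, Fin.val_succ]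
    simp [add_assoc]
    ring
  have hconst : ∑ _i : Fin (k + 3), a = a * (k + 3) := by simp [mul_comm]
  simp only [hrow, Nat.add_sub_cancel, fSYT, hsum, hconst, prod_Ioi_fin_add_three,
    factorial_add_three_eq]
  have h₁ := prod_fin_add_shift k 1
  have h₂ := prod_fin_add_shift k 2
  have h₃ := prod_fin_add_shift k 3
  have hf₀ : ((a + 1 + (k + 2)).factorial : ℚ) = (a + k + 3) * (a + (k + 2)).factorial := by
    rw [show a + 1 + (k + 2) = a + (k + 2) + 1 by ring, Nat.factorial_succ]
    push_cast
    ring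
  have hf₁ : ((a + 1 + (k + 1)).factorial : ℚ) = (a + k + 2) * (a + (k + 1)).factorial := by
    rw [show a + 1 + (k + 1) = a + (k + 1) + 1 by ring, Nat.factorial_succ]
    push_cast
    ring
  have hf₂ : ((a + 1 + k).factorial : ℚ) = (a + k + 1) * (a + k).factorial := by
    rw [show a + 1 + k = a + k + 1 by ring, Nat.factorial_succ]
    push_cast
    ring
  have hmod : 2 % (k + 3) = 2 := Nat.mod_eq_of_lt (by omega)
  have hge (x : ℕ) : ¬ x + 1 + 1 + 1 < 3 := by omega
  have hsub (b : ℕ) : b + (k + 2) - 2 = b + k := by omega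
  simp only [Fin.prod_univ_succ (n := k + 2), Fin.prod_univ_succ (n := k + 1),
    Fin.prod_univ_succ (n := k)]
  simp [hmod, hge, hsub, hf₀, hf₁, hf₂]
  have hadd₂ (x : ℚ) : x + 1 + 1 = x + 2 := by ring
  have hadd₃ (x : ℚ) : x + 2 + 1 = x + 3 := by ring
  have hadd₄ (x : ℚ) : 1 + (x + 3) = x + 4 := by ring
  have hsub₁ (x : ℚ) : x + 3 - 2 = x + 1 := by ring
  have hsub₂ (x : ℚ) : x + 4 - 2 = x + 2 := by ring
  norm_num only at h₁ h₂ h₃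
  simp only [hadd₂, hadd₃, hadd₄, hsub₁, hsub₂]
  generalize ∏ x : Fin k, (((x : ℕ) : ℚ) + 1) = P₁ at *
  generalize ∏ x : Fin k, (((x : ℕ) : ℚ) + 2) = P₂ at *
  generalize ∏ x : Fin k, (((x : ℕ) : ℚ) + 3) = P₃ at *
  generalize ∏ x : Fin k, (((x : ℕ) : ℚ) + 4) = P₄ at *
  have hF : ∏ x : Fin k, ((a + (k + 2) - ((x : ℕ) + 1 + 1 + 1)).factorial : ℚ) ≠ 0 :=
    prod_ne_zero_iff.mpr fun _ _ => by positivity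
  generalize ∏ x : Fin k, ((a + (k + 2) - ((x : ℕ) + 1 + 1 + 1)).factorial : ℚ) = F at *
  generalize ∏ x : Fin k, ∏ y ∈ Ioi x, (((y : ℕ) : ℚ) - ((x : ℕ) : ℚ)) = V
  rw [show (a : ℚ) + 3 + (k + 3) - 3 = a + k + 3 by ring,
    show (a : ℚ) + 3 + (k + 3) - 4 = a + k + 2 by ring,
    show (a : ℚ) + 3 + (k + 3) - 5 = a + k + 1 by ring]
  obtain rfl : P₂ = (k + 1) * P₁ := by linear_combination h₁
  obtain rfl : P₃ = (k + 2) * ((k + 1) * P₁) / 2 := by linear_combination h₂ / 2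
  obtain rfl : P₄ = (k + 3) * ((k + 2) * ((k + 1) * P₁) / 2) / 3 := by linear_combination h₃ / 3
  field_simp
  ring
end

section
/- Let m ≥ 3 and e ≥ 3 be integers, and set N := m + e and M := 3 + (m−3)e. Then f^{(m, (m−3)^{e−1})} + 5 · f^{(m−1, m−2, (m−3)^{e−2})} + 5 · f^{((m−2)^3, (m−3)^{e−3})} = [2e((8e²−6e+1)N² + (−42e²+9e+6)N + 5(8e²+3e+1)) / ((N−1)(N−2)(N−3)(N−4)(N−5))] · C(M, 3) · f^{((m−3)^e)}, where all four shapes are partitions of length e: first part m followed by e − 1 parts m − 3; parts m − 1, m − 2 followed by e − 2 parts m − 3; three parts m − 2 followed by e − 3 parts m − 3; and e copies of m − 3, respectively. -/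
open Finset

/-- The part of `fSYT (k + 3) lam` contributed by the indices at least `3`, for a tuple that is
constantly `a` there. -/
def tailFactor (k a : ℕ) : ℚ :=
  (∏ i : Fin k, ∏ j ∈ Finset.Ioi i, (((j : ℕ) : ℚ) - ((i : ℕ) : ℚ))) /
    ∏ i : Fin k, ((k + a - 1 - (i : ℕ)).factorial : ℚ)

theorem prod_add_one_add_eq_factorial_div (k p : ℕ) :
    ∏ j : Fin k, ((p : ℚ) + 1 + ((j : ℕ) : ℚ)) = ((k + p).factorial : ℚ) / (p.factorial : ℚ) := by
  have hp : (p.factorial : ℚ) ≠ 0 := by positivity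
  rw [Fin.prod_univ_eq_prod_range (fun j : ℕ => (p : ℚ) + 1 + (j : ℚ)) k, eq_div_iff hp]
  induction k with
  | zero => simp
  | succ k ih =>
    rw [Finset.prod_range_succ, mul_right_comm, ih, add_right_comm k 1 p, Nat.factorial_succ]
    push_cast
    ring

theorem fSYT_eq_of_tail_const (k a p q r : ℕ) (lam : Fin (k + 3) → ℕ)
    (h0 : lam ⟨0, by omega⟩ = a + p)
    (h1 : lam ⟨1, by omega⟩ = a + q) (h2 : lam ⟨2, by omega⟩ = a + r)
    (ht : ∀ i : Fin k, lam i.succ.succ.succ = a) :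
    fSYT (k + 3) lam =
      ((a * (k + 3) + (p + q + r)).factorial : ℚ) *
        (((p : ℚ) - q + 1) * ((p : ℚ) - r + 2) * ((q : ℚ) - r + 1)) *
        (((k + (p + 2)).factorial : ℚ) / ((p + 2).factorial : ℚ)) *
        (((k + (q + 1)).factorial : ℚ) / ((q + 1).factorial : ℚ)) *
        (((k + r).factorial : ℚ) / (r.factorial : ℚ)) * tailFactor k a /
        (((k + a + (p + 2)).factorial : ℚ) * ((k + a + (q + 1)).factorial : ℚ) *
          ((k + a + r).factorial : ℚ)) := by
  have h0' : lam 0 = a + p := h0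
  have h1' : lam (Fin.succ 0) = a + q := h1
  have h2' : lam (Fin.succ (Fin.succ 0)) = a + r := h2
  have hs : ∑ i, lam i = a * (k + 3) + (p + q + r) := by
    simp only [Fin.sum_univ_succ, h0', h1', h2', ht, sum_const, card_univ, Fintype.card_fin,
      smul_eq_mul]
    ring
  have hd : ∏ i : Fin (k + 3), ((lam i + (k + 3) - 1 - (i : ℕ)).factorial : ℚ) =
      (((k + a + (p + 2)).factorial : ℚ) * ((k + a + (q + 1)).factorial : ℚ) *
          ((k + a + r).factorial : ℚ)) *
        ∏ i : Fin k, ((k + a - 1 - (i : ℕ)).factorial : ℚ) := by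
    simp only [Fin.prod_univ_succ, h0', h1', h2', ht, Fin.val_succ, Fin.val_zero, ← mul_assoc]
    congr 1
    · congr 4 <;> omega
    · refine Finset.prod_congr rfl fun i _ => ?_
      congr 2
      omega
  have hn : ∏ i : Fin (k + 3), ∏ j ∈ Finset.Ioi i,
        ((lam i : ℚ) - (lam j : ℚ) + ((j : ℕ) : ℚ) - ((i : ℕ) : ℚ)) =
      (((p : ℚ) - q + 1) * ((p : ℚ) - r + 2) * ((q : ℚ) - r + 1)) *
        (∏ j : Fin k, (((p + 2 : ℕ) : ℚ) + 1 + ((j : ℕ) : ℚ))) *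
        (∏ j : Fin k, (((q + 1 : ℕ) : ℚ) + 1 + ((j : ℕ) : ℚ))) *
        (∏ j : Fin k, ((r : ℚ) + 1 + ((j : ℕ) : ℚ))) *
        ∏ i : Fin k, ∏ j ∈ Finset.Ioi i, (((j : ℕ) : ℚ) - ((i : ℕ) : ℚ)) := by
    simp only [Fin.prod_univ_succ, Fin.prod_Ioi_zero, Fin.prod_Ioi_succ, h0', h1', h2', ht,
      Fin.val_succ, Fin.val_zero]
    push_cast
    ring_nf
  rw [fSYT, hs, hn, hd, tailFactor]
  simp only [prod_add_one_add_eq_factorial_div]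
  field_simp

/-- For m >= 3, e >= 3, N := m + e, M := 3 + (m-3)e:
f^{(m, (m-3)^{e-1})} + 5 f^{(m-1, m-2, (m-3)^{e-2})} + 5 f^{((m-2)^3, (m-3)^{e-3})}
= [2e((8e^2-6e+1)N^2 + (-42e^2+9e+6)N + 5(8e^2+3e+1))
    / ((N-1)(N-2)(N-3)(N-4)(N-5))] * C(M,3) * f^{((m-3)^e)},
all shapes of length e. -/
theorem fSYT_threefold_sum (m e N M : ℕ) (hm : 3 ≤ m) (he : 3 ≤ e)
    (hN : N = m + e) (hM : M = 3 + (m - 3) * e) :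
    fSYT e (fun i => if (i : ℕ) = 0 then m else m - 3)
        + 5 * fSYT e (fun i =>
            if (i : ℕ) = 0 then m - 1 else if (i : ℕ) = 1 then m - 2 else m - 3)
        + 5 * fSYT e (fun i => if (i : ℕ) < 3 then m - 2 else m - 3)
      = (2 * (e : ℚ) *
            ((8 * (e : ℚ) ^ 2 - 6 * (e : ℚ) + 1) * (N : ℚ) ^ 2
              + (-42 * (e : ℚ) ^ 2 + 9 * (e : ℚ) + 6) * (N : ℚ)
              + 5 * (8 * (e : ℚ) ^ 2 + 3 * (e : ℚ) + 1)) /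
            (((N : ℚ) - 1) * ((N : ℚ) - 2) * ((N : ℚ) - 3) * ((N : ℚ) - 4) * ((N : ℚ) - 5))) *
          (M.choose 3 : ℚ) * fSYT e (fun _ => m - 3) := by
  obtain ⟨a, rfl⟩ := Nat.exists_eq_add_of_le' hm
  obtain ⟨k, rfl⟩ := Nat.exists_eq_add_of_le' he
  subst hN hM
  have row := fSYT_eq_of_tail_const k a 3 0 0
    (fun i => if (i : ℕ) = 0 then a + 3 else a + 3 - 3) rfl rfl rfl (by simp)
  have hook := fSYT_eq_of_tail_const k a 2 1 0
    (fun i => if (i : ℕ) = 0 then a + 3 - 1 else if (i : ℕ) = 1 then a + 3 - 2 else a + 3 - 3)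
    rfl rfl rfl (by simp)
  have column := fSYT_eq_of_tail_const k a 1 1 1
    (fun i => if (i : ℕ) < 3 then a + 3 - 2 else a + 3 - 3)
    rfl rfl rfl (by simp)
  have rectangle := fSYT_eq_of_tail_const k a 0 0 0 (fun _ => a + 3 - 3)
    rfl rfl rfl (by simp)
  rw [row, hook, column, rectangle, Nat.cast_add_choose]
  generalize tailFactor k a = T
  have hM : ((a * (k + 3)).factorial : ℚ) ≠ 0 := by positivity
  simp only [Nat.add_sub_cancel, add_zero, add_comm 3 (a * (k + 3)), Nat.reduceAdd]
  generalize (((a * (k + 3)).factorial : ℕ) : ℚ) = R at hM ⊢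
  generalize (((a * (k + 3) + 3).factorial : ℕ) : ℚ) = S
  have hk : (k.factorial : ℚ) ≠ 0 := by positivity
  have ha : ((k + a).factorial : ℚ) ≠ 0 := by positivity
  simp only [Nat.factorial_succ, Nat.factorial_zero]
  push_cast
  have shift (c : ℚ) : (a : ℚ) + 3 + (k + 3) - c = k + a + (6 - c) := by ring
  simp only [shift]
  norm_num only [add_assoc]
  field_simp
  ring
end
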